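/- arXiv:2505.22237 — 2 statements merged into one kernel-verified Lean document; each statement's English description precedes it below -/
import Mathlib

section
/- Let k be a field of characteristic 2 and let F be a field extension of k. Let a₁, a₂, a₃ ∈ F and b₁, b₂, b₃ ∈ Fˣ be such that the tensor product [a₁,b₁)_F ⊗_F [a₂,b₂)_F ⊗_F [a₃,b₃)_F is split. Then there exist an intermediate field L with k ⊆ L ⊆ F whose transcendence degree over k is at most 3, an element a ∈ L, and elements c₁, c₂ ∈ L \ {0} such that [a,c₁)_F ≅ [a₁,b₁)_F, [a,c₂)_F ≅ [a₂,b₂)_F and [a,c₁c₂)_F ≅ [a₃,b₃)_F as F-algebras, and the tensor product [a,c₁)_L ⊗_L [a,c₂)_L ⊗_L [a,c₁c₂)_L is split over L. -/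
open FreeAlgebra in
inductive QuatRel (F : Type*) [Field F] (a b : F) :
    FreeAlgebra F (Fin 2) → FreeAlgebra F (Fin 2) → Prop
  | u_sq : QuatRel F a b (ι F 0 * ι F 0 - ι F 0) (algebraMap F _ a)
  | v_sq : QuatRel F a b (ι F 1 * ι F 1) (algebraMap F _ b)
  | vu : QuatRel F a b (ι F 1 * ι F 0) ((1 - ι F 0) * ι F 1)

/-- The quaternion algebra `[a,b)_F` over a field of characteristic `2`:
generated by `u, v` with `u² - u = a`, `v² = b`, `vu = (1-u)v`. -/
def QuatAlg (F : Type*) [Field F] (a b : F) : Type _ :=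
  RingQuot (QuatRel F a b)

instance (F : Type*) [Field F] (a b : F) : Ring (QuatAlg F a b) :=
  inferInstanceAs (Ring (RingQuot (QuatRel F a b)))

instance (F : Type*) [Field F] (a b : F) : Algebra F (QuatAlg F a b) :=
  inferInstanceAs (Algebra F (RingQuot (QuatRel F a b)))

open scoped TensorProduct

/-- The transcendence degree of `L` over `k`: the supremum of cardinalities of
algebraically independent subsets of `L`. -/
noncomputable def trdeg (k L : Type*) [CommRing k] [CommRing L] [Algebra k L] : Cardinal :=
  ⨆ s : { s : Set L // AlgebraicIndependent k ((↑) : s → L) }, Cardinal.mk s.1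

section QuaternionChar2

open scoped Quaternion

variable {F : Type*} [Field F]

namespace QuaternionAlgebra

/-- The homomorphism from `ℍ[F,a,1,b]` determined by the images of the two generators. -/
def homOfRel {A : Type*} [Ring A] [Algebra F A] {a b : F} (i j : A)
    (hi : i * i = algebraMap F A a + i) (hj : j * j = algebraMap F A b)
    (hji : j * i = j - i * j) : ℍ[F,a,1,b] →ₐ[F] A :=
  Basis.liftHom
    { i := i
      j := j
      k := i * j
      i_mul_i := by rw [hi, one_smul, Algebra.algebraMap_eq_smul_one]
      j_mul_j := by rw [hj, Algebra.algebraMap_eq_smul_one]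
      i_mul_j := rfl
      j_mul_i := by rw [hji, one_smul] }

theorem homOfRel_apply {A : Type*} [Ring A] [Algebra F A] {a b : F} (i j : A)
    (hi : i * i = algebraMap F A a + i) (hj : j * j = algebraMap F A b)
    (hji : j * i = j - i * j) (x : ℍ[F,a,1,b]) :
    homOfRel i j hi hj hji x =
      algebraMap F A x.re + x.imI • i + x.imJ • j + x.imK • (i * j) := by
  simp [homOfRel, Basis.lift]

/-- The reduced norm of `ℍ[F,a,1,b]`. -/
def nrd {a b : F} (x : ℍ[F,a,1,b]) : F :=
  x.re ^ 2 + x.re * x.imI - a * x.imI ^ 2 - b * (x.imJ ^ 2 + x.imJ * x.imK - a * x.imK ^ 2)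

theorem mul_star_eq_nrd {a b : F} (x : ℍ[F,a,1,b]) :
    x * star x = algebraMap F ℍ[F,a,1,b] (nrd x) := by
  rw [algebraMap_eq]
  ext <;> simp [nrd] <;> ring

theorem mul_self_eq {a b : F} (x : ℍ[F,a,1,b]) :
    x * x = (2 * x.re + x.imI) • x - algebraMap F ℍ[F,a,1,b] (nrd x) := by
  rw [algebraMap_eq]
  ext <;> simp [nrd] <;> ring

theorem star_mul_eq_nrd {a b : F} (x : ℍ[F,a,1,b]) :
    star x * x = algebraMap F ℍ[F,a,1,b] (nrd x) := by
  rw [algebraMap_eq]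
  ext <;> simp [nrd] <;> ring

theorem isUnit_of_nrd_ne_zero {a b : F} {x : ℍ[F,a,1,b]} (hx : nrd x ≠ 0) : IsUnit x := by
  refine ⟨⟨x, (nrd x)⁻¹ • star x, ?_, ?_⟩, rfl⟩
  · rw [mul_smul_comm, mul_star_eq_nrd, Algebra.smul_def, ← map_mul, inv_mul_cancel₀ hx, map_one]
  · rw [smul_mul_assoc, star_mul_eq_nrd, Algebra.smul_def, ← map_mul, inv_mul_cancel₀ hx, map_one]

theorem isSimpleRing_of_charTwo [CharP F 2] {a b : F} (hb : b ≠ 0) :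
    IsSimpleRing ℍ[F,a,1,b] := by
  have h2 : (2 : F) = 0 := CharTwo.two_eq_zero
  refine IsSimpleRing.of_eq_bot_or_eq_top fun I => ?_
  by_cases hI : I = ⊥
  · exact .inl hI
  right
  have key : ∀ x : ℍ[F,a,1,b], x ∈ I → x ≠ 0 → ∃ y : ℍ[F,a,1,b], y ∈ I ∧ IsUnit y := by
    have key' : ∀ p q : F, (⟨p, q, 0, 0⟩ : ℍ[F,a,1,b]) ∈ I → (p ≠ 0 ∨ q ≠ 0) →
        ∃ y : ℍ[F,a,1,b], y ∈ I ∧ IsUnit y := by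
      intro p q hpq h0
      by_cases hq : q = 0
      · subst hq
        exact ⟨_, hpq, isUnit_of_nrd_ne_zero (by simpa [nrd] using h0)⟩
      · refine ⟨_, I.add_mem (I.mul_mem_left ⟨0, 0, 1, 0⟩ _ hpq)
          (I.mul_mem_right _ ⟨0, 0, 1, 0⟩ hpq), isUnit_of_nrd_ne_zero ?_⟩
        have : p + q + p = q := by linear_combination p * h2
        simp [nrd, this, hq, hb]
    intro x hx hx0
    have hxI := I.add_mem (I.mul_mem_left ⟨0, 1, 0, 0⟩ _ hx) (I.mul_mem_right _ ⟨0, 1, 0, 0⟩ hx)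
    have hxJ := I.mul_mem_right _ ⟨0, 0, 1, 0⟩ hxI
    by_cases h : x.imJ = 0 ∧ x.imK = 0
    · refine key' x.re x.imI ?_ ?_
      · convert hx
        · exact h.1.symm
        · exact h.2.symm
      · by_contra! h0
        exact hx0 (by ext <;> simp [h, h0])
    · refine key' (b * x.imJ) (b * x.imK) ?_ ?_
      · convert hxJ using 1
        ext <;> simp <;> grind
      · simpa [hb, or_iff_not_imp_left] using h
  obtain ⟨x, hx, hx0⟩ : ∃ x ∈ I, x ≠ 0 := by
    by_contra! h
    exact hI (eq_bot_iff.2 fun x hx => h x hx)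
  obtain ⟨y, hy, u, rfl⟩ := key x hx hx0
  rw [← TwoSidedIdeal.one_mem_iff]
  simpa using I.mul_mem_left (↑u⁻¹) _ hy

theorem bijective_of_finrank [CharP F 2] {a b : F} (hb : b ≠ 0) {A : Type*} [Ring A]
    [Algebra F A] [Nontrivial A] (hA : Module.finrank F A = 4) (f : ℍ[F,a,1,b] →ₐ[F] A) :
    Function.Bijective f := by
  have := isSimpleRing_of_charTwo (a := a) hb
  have hf : Function.Injective f := (f : ℍ[F,a,1,b] →+* A).injective
  have : Module.Finite F A := Module.finite_of_finrank_pos (by omega)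
  exact ⟨hf, (LinearMap.injective_iff_surjective_of_finrank_eq_finrank
    (f := f.toLinearMap) (by rw [hA, finrank_eq_four])).1 hf⟩

theorem nonempty_algEquiv_of_hom [CharP F 2] {a b a' b' : F} (hb : b ≠ 0)
    (f : ℍ[F,a,1,b] →ₐ[F] ℍ[F,a',1,b']) : Nonempty (ℍ[F,a,1,b] ≃ₐ[F] ℍ[F,a',1,b']) :=
  ⟨.ofBijective f (bijective_of_finrank hb (finrank_eq_four _ _ _) f)⟩

theorem nonempty_algEquiv_matrix_of_hom [CharP F 2] {a b : F} (hb : b ≠ 0)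
    (f : ℍ[F,a,1,b] →ₐ[F] Matrix (Fin 2) (Fin 2) F) :
    Nonempty (ℍ[F,a,1,b] ≃ₐ[F] Matrix (Fin 2) (Fin 2) F) :=
  ⟨.ofBijective f (bijective_of_finrank hb (by simp [Module.finrank_matrix]) f)⟩

theorem nonempty_algEquiv_matrix_of_eq_sq_add_self [CharP F 2] {a b r : F} (hb : b ≠ 0)
    (ha : a = r ^ 2 + r) : Nonempty (ℍ[F,a,1,b] ≃ₐ[F] Matrix (Fin 2) (Fin 2) F) := by
  have h2 : (2 : F) = 0 := CharTwo.two_eq_zero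
  refine nonempty_algEquiv_matrix_of_hom hb
    (homOfRel !![r, 0; 0, r + 1] !![0, b; 1, 0] ?_ ?_ ?_)
  all_goals
    ext i j
    fin_cases i <;> fin_cases j <;> simp [Matrix.mul_apply, Matrix.algebraMap_matrix_apply] <;>
      grind

theorem nonempty_algEquiv_matrix_of_norm [CharP F 2] {a b p q : F} (hb : b ≠ 0)
    (h : b = p ^ 2 + p * q + a * q ^ 2) :
    Nonempty (ℍ[F,a,1,b] ≃ₐ[F] Matrix (Fin 2) (Fin 2) F) := by
  have h2 : (2 : F) = 0 := CharTwo.two_eq_zero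
  refine nonempty_algEquiv_matrix_of_hom hb
    (homOfRel !![0, a; 1, 1] !![p, p + a * q; q, p] ?_ ?_ ?_)
  all_goals
    ext i j
    fin_cases i <;> fin_cases j <;> simp [Matrix.mul_apply, Matrix.algebraMap_matrix_apply] <;>
      grind

theorem nonempty_algEquiv_matrix_of_nrd_eq_zero [CharP F 2] {a b : F} (hb : b ≠ 0)
    {x : ℍ[F,a,1,b]} (hx : x ≠ 0) (hn : nrd x = 0) :
    Nonempty (ℍ[F,a,1,b] ≃ₐ[F] Matrix (Fin 2) (Fin 2) F) := by
  have h2 : (2 : F) = 0 := CharTwo.two_eq_zero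
  have key : ∀ p q : F, (p ≠ 0 ∨ q ≠ 0) → p ^ 2 + p * q + a * q ^ 2 = 0 →
      Nonempty (ℍ[F,a,1,b] ≃ₐ[F] Matrix (Fin 2) (Fin 2) F) := by
    intro p q h0 h
    have hq : q ≠ 0 := by
      rintro rfl
      simp_all
    refine nonempty_algEquiv_matrix_of_eq_sq_add_self (r := p / q) hb ?_
    field_simp
    grind
  obtain ⟨p, q, r, s⟩ := x
  simp only [nrd] at hn
  by_cases h : r ^ 2 + r * s + a * s ^ 2 = 0
  · by_cases hrs : r = 0 ∧ s = 0
    · refine key p q ?_ (by grind)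
      by_contra! h0
      exact hx (by ext <;> simp [h0, hrs])
    · exact key r s (by tauto) h
  · refine nonempty_algEquiv_matrix_of_norm hb (p := (p * r + a * q * s + p * s) / (r ^ 2 + r * s + a * s ^ 2))
      (q := (q * r + p * s) / (r ^ 2 + r * s + a * s ^ 2)) ?_
    field_simp
    grind

theorem nonempty_algEquiv_matrix_one [CharP F 2] (a : F) :
    Nonempty (ℍ[F,a,1,(1 : F)] ≃ₐ[F] Matrix (Fin 2) (Fin 2) F) :=
  nonempty_algEquiv_matrix_of_norm one_ne_zero (p := 1) (q := 0) (by simp)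

theorem mul_self_of_imI_eq_one [CharP F 2] {a b : F} {w : ℍ[F,a,1,b]} (hw : w.imI = 1) :
    w * w = algebraMap F _ (nrd w) + w := by
  have h2 : (2 : F) = 0 := CharTwo.two_eq_zero
  rw [mul_self_eq, hw, algebraMap_eq]
  ext <;> simp <;> grind

theorem mul_self_of_imI_eq_zero [CharP F 2] {a b : F} {w : ℍ[F,a,1,b]} (hw : w.imI = 0) :
    w * w = algebraMap F _ (nrd w) := by
  have h2 : (2 : F) = 0 := CharTwo.two_eq_zero
  rw [mul_self_eq, hw, algebraMap_eq]
  ext <;> simp <;> grind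

/-- Every element of trace `1` is the first generator in some presentation. -/
theorem exists_algEquiv_of_imI_eq_one [CharP F 2] {a b : F} (hb : b ≠ 0) {w : ℍ[F,a,1,b]}
    (hw : w.imI = 1) : ∃ c : F, c ≠ 0 ∧ Nonempty (ℍ[F,nrd w,1,c] ≃ₐ[F] ℍ[F,a,1,b]) := by
  have h2 : (2 : F) = 0 := CharTwo.two_eq_zero
  obtain ⟨z, hz⟩ : ∃ z : ℍ[F,a,1,b], nrd (w * z - z * w) ≠ 0 := by
    obtain ⟨r, q, p, s⟩ := w
    obtain rfl : q = 1 := hw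
    by_contra! h
    have e1 := h ⟨0, 1, 0, 0⟩
    have e2 := h ⟨0, 0, 1, 0⟩
    have e3 := h ⟨0, 0, 0, 1⟩
    have e4 := h ⟨0, 0, 1, 1⟩
    simp [nrd] at e1 e2 e3 e4
    grind
  have hI : (w * z - z * w).imI = 0 := by
    simp
    grind
  refine ⟨_, hz, nonempty_algEquiv_of_hom hz (homOfRel w (w * z - z * w)
    (mul_self_of_imI_eq_one hw) (mul_self_of_imI_eq_zero hI) ?_)⟩
  have e := mul_self_of_imI_eq_one hw
  have e1 : w * (w * z) = (algebraMap F _ (nrd w) + w) * z := by rw [← mul_assoc, e]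
  have e2 : z * w * w = z * (algebraMap F _ (nrd w) + w) := by rw [mul_assoc, e]
  rw [sub_mul, mul_sub, e1, e2, add_mul, mul_add, Algebra.commutes, mul_assoc]
  abel

/-- Every noncentral element of trace `0` is the second generator in some presentation. -/
theorem exists_algEquiv_of_imI_eq_zero [CharP F 2] {a b : F} (hb : b ≠ 0) {x : ℍ[F,a,1,b]}
    (hx : x.imI = 0) (hx' : x.imJ ≠ 0 ∨ x.imK ≠ 0) (hn : nrd x ≠ 0) :
    ∃ a' : F, Nonempty (ℍ[F,a',1,nrd x] ≃ₐ[F] ℍ[F,a,1,b]) := by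
  have h2 : (2 : F) = 0 := CharTwo.two_eq_zero
  obtain ⟨y, z, hyz⟩ : ∃ y z : F, (x.imJ * z - x.imK * y) * b = x.re := by
    rcases hx' with h | h
    · exact ⟨0, x.re / (x.imJ * b), by field_simp; simp⟩
    · exact ⟨-x.re / (x.imK * b), 0, by field_simp; simp⟩
  refine ⟨_, nonempty_algEquiv_of_hom hn (homOfRel ⟨0, 1, y, z⟩ x
    (mul_self_of_imI_eq_one rfl) (mul_self_of_imI_eq_zero hx) ?_)⟩
  ext <;> simp [hx] <;> grind

/-- Quaternion algebras with a common inseparable slot have a common separable slot. -/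
theorem exists_common_slot_of_inseparable [CharP F 2] {α β d : F} (hd : d ≠ 0) :
    ∃ a c₁ c₂ : F, c₁ ≠ 0 ∧ c₂ ≠ 0 ∧ Nonempty (ℍ[F,a,1,c₁] ≃ₐ[F] ℍ[F,α,1,d]) ∧
      Nonempty (ℍ[F,a,1,c₂] ≃ₐ[F] ℍ[F,β,1,d]) := by
  have h2 : (2 : F) = 0 := CharTwo.two_eq_zero
  obtain ⟨c₁, hc₁, e₁⟩ := exists_algEquiv_of_imI_eq_one hd
    (w := (⟨0, 1, (α + β) / d + α, 1⟩ : ℍ[F,α,1,d])) rfl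
  obtain ⟨c₂, hc₂, e₂⟩ := exists_algEquiv_of_imI_eq_one hd
    (w := (⟨0, 1, (α + β) / d + α, 0⟩ : ℍ[F,β,1,d])) rfl
  have h : nrd (⟨0, 1, (α + β) / d + α, 0⟩ : ℍ[F,β,1,d]) =
      nrd (⟨0, 1, (α + β) / d + α, 1⟩ : ℍ[F,α,1,d]) := by
    simp only [nrd]
    field_simp
    grind
  exact ⟨_, c₁, c₂, hc₁, hc₂, e₁, h ▸ e₂⟩

/-- Two quaternion division algebras containing noncentral elements with the same trace and norm
have a common separable slot. -/
theorem exists_common_slot_of_nrd_eq [CharP F 2] {a₁ b₁ a₂ b₂ : F} (hb₁ : b₁ ≠ 0) (hb₂ : b₂ ≠ 0)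
    (h₁ : ∀ x : ℍ[F,a₁,1,b₁], nrd x = 0 → x = 0)
    {x : ℍ[F,a₁,1,b₁]} {y : ℍ[F,a₂,1,b₂]} (hI : x.imI = y.imI) (hn : nrd x = nrd y)
    (hx : x.im ≠ 0) (hy : y.im ≠ 0) :
    ∃ a c₁ c₂ : F, c₁ ≠ 0 ∧ c₂ ≠ 0 ∧ Nonempty (ℍ[F,a,1,c₁] ≃ₐ[F] ℍ[F,a₁,1,b₁]) ∧
      Nonempty (ℍ[F,a,1,c₂] ≃ₐ[F] ℍ[F,a₂,1,b₂]) := by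
  by_cases h0 : x.imI = 0
  · have hn0 : nrd x ≠ 0 := fun h => hx (by rw [h₁ x h]; rfl)
    have hx' : x.imJ ≠ 0 ∨ x.imK ≠ 0 := by
      by_contra! h
      exact hx (by ext <;> simp [h, h0])
    have hy' : y.imJ ≠ 0 ∨ y.imK ≠ 0 := by
      by_contra! h
      exact hy (by ext <;> simp [h, h0, ← hI])
    obtain ⟨α, ⟨e₁⟩⟩ := exists_algEquiv_of_imI_eq_zero hb₁ h0 hx' hn0
    obtain ⟨β, ⟨e₂⟩⟩ := exists_algEquiv_of_imI_eq_zero hb₂ (hI ▸ h0) hy' (hn ▸ hn0)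
    rw [← hn] at e₂
    obtain ⟨a, c₁, c₂, hc₁, hc₂, ⟨g₁⟩, ⟨g₂⟩⟩ :=
      exists_common_slot_of_inseparable (α := α) (β := β) hn0
    exact ⟨a, c₁, c₂, hc₁, hc₂, ⟨g₁.trans e₁⟩, ⟨g₂.trans e₂⟩⟩
  · obtain ⟨c₁, hc₁, e₁⟩ := exists_algEquiv_of_imI_eq_one hb₁ (w := x.imI⁻¹ • x) (by simp [h0])
    obtain ⟨c₂, hc₂, e₂⟩ := exists_algEquiv_of_imI_eq_one hb₂ (w := x.imI⁻¹ • y)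
      (by simp [← hI, h0])
    have h : nrd (x.imI⁻¹ • y) = nrd (x.imI⁻¹ • x) := by
      simp only [nrd, re_smul, imI_smul, imJ_smul, imK_smul, smul_eq_mul] at hn ⊢
      linear_combination -x.imI⁻¹ ^ 2 * hn
    exact ⟨_, c₁, c₂, hc₁, hc₂, e₁, h ▸ e₂⟩

theorem map_generators_relations {A : Type*} [Ring A] [Algebra F A] {a b : F}
    (f : ℍ[F,a,1,b] →ₐ[F] A) :
    f ⟨0, 1, 0, 0⟩ * f ⟨0, 1, 0, 0⟩ = algebraMap F _ a + f ⟨0, 1, 0, 0⟩ ∧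
      f ⟨0, 0, 1, 0⟩ * f ⟨0, 0, 1, 0⟩ = algebraMap F _ b ∧
      f ⟨0, 0, 1, 0⟩ * f ⟨0, 1, 0, 0⟩ =
        f ⟨0, 0, 1, 0⟩ - f ⟨0, 1, 0, 0⟩ * f ⟨0, 0, 1, 0⟩ := by
  refine ⟨?_, ?_, ?_⟩
  · rw [← AlgHom.commutes f, ← map_mul, ← map_add, algebraMap_eq]
    congr 1
    ext <;> simp
  · rw [← AlgHom.commutes f, ← map_mul, algebraMap_eq]
    congr 1
    ext <;> simp
  · rw [← map_mul, ← map_mul, ← map_sub]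
    congr 1
    ext <;> simp

theorem commute_homOfRel {A : Type*} [Ring A] [Algebra F A] {a b : F} {i j z : A}
    (hi : i * i = algebraMap F A a + i) (hj : j * j = algebraMap F A b)
    (hji : j * i = j - i * j) (hiz : Commute i z) (hjz : Commute j z) (x : ℍ[F,a,1,b]) :
    Commute (homOfRel i j hi hj hji x) z := by
  rw [homOfRel_apply]
  exact (((Algebra.commute_algebraMap_left x.re z).add_left (hiz.smul_left _)).add_left
    (hjz.smul_left _)).add_left ((hiz.mul_left hjz).smul_left _)

theorem add_self_eq_zero_of_charTwo (F : Type*) [Field F] [CharP F 2] {A : Type*} [Ring A]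
    [Algebra F A] (x : A) : x + x = 0 := by
  rw [← two_smul F, CharTwo.two_eq_zero, zero_smul]

theorem exists_eq_algebraMap_of_im_eq_zero {a b : F} {x : ℍ[F,a,1,b]} (hx : x.im = 0) :
    ∃ p, x = algebraMap F _ p := by
  refine ⟨x.re, ?_⟩
  rw [algebraMap_eq]
  ext
  · rfl
  · exact (congrArg imI hx :)
  · exact (congrArg imJ hx :)
  · exact (congrArg imK hx :)

theorem sq_add_self_ne_of_division [CharP F 2] {a b : F}
    (h : ∀ x : ℍ[F,a,1,b], nrd x = 0 → x = 0) (p : F) : p ^ 2 + p ≠ a := by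
  intro hp
  have := congrArg imI (h ⟨p, 1, 0, 0⟩ (by simp [nrd, ← hp]))
  simp at this

theorem norm_ne_of_division [CharP F 2] {a b : F}
    (h : ∀ x : ℍ[F,a,1,b], nrd x = 0 → x = 0) (p q : F) : p ^ 2 + p * q - a * q ^ 2 ≠ b := by
  intro hp
  have := congrArg imJ (h ⟨p, q, 1, 0⟩ (by simp [nrd, ← hp]))
  simp at this

theorem eq_smul_add_algebraMap_of_commute [CharP F 2] {a b : F} (hb : b ≠ 0)
    {x y : ℍ[F,a,1,b]} (hy : y.im ≠ 0) (h : x * y = y * x) :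
    ∃ p q : F, x = algebraMap F _ p + q • y := by
  have h2 : (2 : F) = 0 := CharTwo.two_eq_zero
  have e0 := congrArg re h
  have e1 := congrArg imI h
  have e2 := congrArg imJ h
  have e3 := congrArg imK h
  simp at e0 e1 e2 e3
  have f0 : x.imJ * y.imK = x.imK * y.imJ := by
    apply mul_left_cancel₀ hb
    grind
  have f2 : x.imI * y.imJ = x.imJ * y.imI := by grind
  have f3 : x.imI * y.imK = x.imK * y.imI := by grind
  have hy' : y.imI ≠ 0 ∨ y.imJ ≠ 0 ∨ y.imK ≠ 0 := by
    by_contra! h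
    exact hy (by ext <;> simp [h])
  have key : ∃ q, x.imI = q * y.imI ∧ x.imJ = q * y.imJ ∧ x.imK = q * y.imK := by
    rcases hy' with h | h | h
    · exact ⟨x.imI / y.imI, by field_simp, by field_simp; grind, by field_simp; grind⟩
    · exact ⟨x.imJ / y.imJ, by field_simp; grind, by field_simp, by field_simp; grind⟩
    · exact ⟨x.imK / y.imK, by field_simp; grind, by field_simp; grind, by field_simp⟩
  obtain ⟨q, h1, h2, h3⟩ := key
  refine ⟨x.re - q * y.re, q, ?_⟩
  rw [algebraMap_eq]
  ext <;> simp [h1, h2, h3]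

theorem imI_and_nrd_of_mul_self_eq [CharP F 2] {a b t n : F} {x : ℍ[F,a,1,b]} (hx : x.im ≠ 0)
    (h : x * x = t • x + algebraMap F _ n) : x.imI = t ∧ nrd x = n := by
  have h2 : (2 : F) = 0 := CharTwo.two_eq_zero
  rw [mul_self_eq, algebraMap_eq, algebraMap_eq] at h
  have e0 := congrArg re h
  have e1 := congrArg imI h
  have e2 := congrArg imJ h
  have e3 := congrArg imK h
  simp [h2] at e0 e1 e2 e3
  have hx' : x.imI ≠ 0 ∨ x.imJ ≠ 0 ∨ x.imK ≠ 0 := by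
    by_contra! h
    exact hx (by ext <;> simp [h])
  have : x.imI = t := by grind
  refine ⟨this, ?_⟩
  grind

/-- A commutative `F`-algebra relation `x² + yx = ay² + b` between commuting elements of a
quaternion division algebra forces a common slot with `ℍ[F,a,1,b]`. -/
theorem exists_nrd_eq_of_commute [CharP F 2] {a₁ b₁ a₂ b₂ : F} (hb₁ : b₁ ≠ 0)
    (h₂ : ∀ x : ℍ[F,a₂,1,b₂], nrd x = 0 → x = 0) {x y : ℍ[F,a₁,1,b₁]} (hxy : x * y = y * x)
    (h : x * x + y * x - a₂ • (y * y) = algebraMap F _ b₂) :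
    ∃ (z : ℍ[F,a₁,1,b₁]) (w : ℍ[F,a₂,1,b₂]), z.imI = w.imI ∧ nrd z = nrd w ∧
      z.im ≠ 0 ∧ w.im ≠ 0 := by
  have h2 : (2 : F) = 0 := CharTwo.two_eq_zero
  by_cases hy : y.im = 0
  · obtain ⟨q, rfl⟩ : ∃ q, y = algebraMap F _ q := exists_eq_algebraMap_of_im_eq_zero hy
    have hx : x.im ≠ 0 := by
      intro hx
      obtain ⟨p, rfl⟩ : ∃ p, x = algebraMap F _ p := exists_eq_algebraMap_of_im_eq_zero hx
      have e := congrArg re h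
      simp [algebraMap_eq] at e
      exact norm_ne_of_division h₂ p q (by linear_combination e)
    have hx2 : x * x = q • x + algebraMap F _ (b₂ + a₂ * q ^ 2) := by
      have e : x * x = algebraMap F _ b₂ - q • x + a₂ • (q ^ 2 • 1) := by
        rw [← h, Algebra.smul_def q, ← Algebra.algebraMap_eq_smul_one, pow_two, map_mul]
        abel
      rw [e, algebraMap_eq, algebraMap_eq]
      clear h e hxy
      ext <;> simp <;> grind
    obtain ⟨e1, e2⟩ := imI_and_nrd_of_mul_self_eq hx hx2
    refine ⟨x, ⟨0, q, 1, 0⟩, e1, ?_, hx, fun h => by simpa using congrArg imJ h⟩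
    rw [e2]
    simp [nrd]
    linear_combination (b₂ + a₂ * q ^ 2) * h2
  · obtain ⟨p, q, rfl⟩ := eq_smul_add_algebraMap_of_commute hb₁ hy hxy
    have hN : q ^ 2 + q + a₂ ≠ 0 := by
      intro hN
      exact sq_add_self_ne_of_division h₂ q (by linear_combination hN - a₂ * h2)
    obtain ⟨N, hN'⟩ : ∃ N, q ^ 2 + q + a₂ = N := ⟨_, rfl⟩
    rw [hN'] at hN
    have hy2 : y * y = (p / N) • y + algebraMap F _ ((b₂ + p ^ 2) / N) := by
      have e : N • (y * y) = p • y + algebraMap F _ (b₂ + p ^ 2) := by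
        rw [map_add, ← h, ← hN', pow_two p]
        simp only [mul_add, add_mul, map_mul, smul_mul_assoc, mul_smul_comm,
          Algebra.algebraMap_eq_smul_one, one_mul, mul_one, smul_smul]
        generalize y * y = Y
        ext <;> simp <;> grind
      apply smul_right_injective _ hN
      simp only [smul_add, smul_smul] at e ⊢
      rw [e, Algebra.algebraMap_eq_smul_one, Algebra.algebraMap_eq_smul_one, smul_smul]
      congr 2 <;> field_simp
    obtain ⟨e1, e2⟩ := imI_and_nrd_of_mul_self_eq hy hy2
    refine ⟨y, ⟨(q + 1) * p / N, p / N, (q + 1) / N, 1 / N⟩, e1, ?_, hy, fun h => ?_⟩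
    · rw [e2]
      clear h hxy hy2 e1 e2 h₂
      simp only [nrd]
      field_simp
      grind
    · have := congrArg imK h
      simp [hN] at this

theorem exists_nrd_eq_of_commute_end [CharP F 2] {a₁ b₁ a₂ b₂ : F} (hb₁ : b₁ ≠ 0)
    (h₁ : ∀ x : ℍ[F,a₁,1,b₁], nrd x = 0 → x = 0) (h₂ : ∀ x : ℍ[F,a₂,1,b₂], nrd x = 0 → x = 0)
    {V : Type*} [AddCommGroup V] [Module F V] (hV : Module.finrank F V = 8)
    (f₁ : ℍ[F,a₁,1,b₁] →ₐ[F] Module.End F V) (f₂ : ℍ[F,a₂,1,b₂] →ₐ[F] Module.End F V)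
    (hf : ∀ x y, Commute (f₁ x) (f₂ y)) :
    ∃ (z : ℍ[F,a₁,1,b₁]) (w : ℍ[F,a₂,1,b₂]), z.imI = w.imI ∧ nrd z = nrd w ∧
      z.im ≠ 0 ∧ w.im ≠ 0 := by
  have h2 : (2 : F) = 0 := CharTwo.two_eq_zero
  have : Module.Finite F V := Module.finite_of_finrank_pos (by omega)
  have : Nontrivial V := Module.nontrivial_of_finrank_pos (R := F) (by omega)
  obtain ⟨m, hm⟩ := exists_ne (0 : V)
  let U := f₂ ⟨0, 1, 0, 0⟩
  let W := f₂ ⟨0, 0, 1, 0⟩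
  obtain ⟨p₂, q₂, r₂⟩ := map_generators_relations f₂
  have hUU : ∀ v, U (U v) = a₂ • v + U v := fun v => by simpa using LinearMap.congr_fun p₂ v
  have hWW : ∀ v, W (W v) = b₂ • v := fun v => by simpa using LinearMap.congr_fun q₂ v
  have hWU : ∀ v, W (U v) = W v - U (W v) := fun v => by simpa using LinearMap.congr_fun r₂ v
  have hU : ∀ x v, U (f₁ x v) = f₁ x (U v) := fun x v =>
    (LinearMap.congr_fun (hf x ⟨0, 1, 0, 0⟩) v).symm
  have hW : ∀ x v, W (f₁ x v) = f₁ x (W v) := fun x v =>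
    (LinearMap.congr_fun (hf x ⟨0, 0, 1, 0⟩) v).symm
  have hinj : ∀ x v, v ≠ 0 → f₁ x v = 0 → x = 0 := by
    intro x v hv h
    by_contra hx
    obtain ⟨y, hy⟩ := (isUnit_of_nrd_ne_zero fun hn => hx (h₁ x hn)).exists_left_inv
    apply hv
    rw [← Module.End.one_apply (R := F) v, ← map_one f₁, ← hy, map_mul, Module.End.mul_apply, h,
      map_zero]
  let φ : ℍ[F,a₁,1,b₁] × ℍ[F,a₁,1,b₁] →ₗ[F] V :=
    (LinearMap.applyₗ m ∘ₗ f₁.toLinearMap).coprod (LinearMap.applyₗ (U m) ∘ₗ f₁.toLinearMap)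
  have hφ : ∀ x y, φ (x, y) = f₁ x m + f₁ y (U m) := fun x y => rfl
  by_cases hi : Function.Injective φ
  · have hs := (LinearMap.injective_iff_surjective_of_finrank_eq_finrank
      (by rw [hV, Module.finrank_prod, finrank_eq_four])).1 hi
    obtain ⟨⟨x, y⟩, hxy⟩ := hs (W m)
    rw [hφ] at hxy
    have e : φ (x * x + y * x - a₂ • (y * y) - algebraMap F _ b₂, x * y - y * x) = 0 := by
      have := hWW m
      rw [← hxy, map_add, hW, hW, hWU, ← hxy] at this
      simp only [map_add, map_smul, hU, hUU] at this
      rw [hφ]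
      simp only [map_add, map_sub, map_mul, map_smul, Module.End.mul_apply, LinearMap.add_apply,
        LinearMap.sub_apply, LinearMap.smul_apply, AlgHom.commutes,
        Module.algebraMap_end_apply] at this ⊢
      rw [← this]
      module
    have e' := hi (e.trans (map_zero φ).symm)
    rw [Prod.mk_eq_zero, sub_eq_zero, sub_eq_zero] at e'
    exact exists_nrd_eq_of_commute hb₁ h₂ e'.2 e'.1
  · obtain ⟨⟨x, y⟩, hxy, h0⟩ : ∃ z, φ z = 0 ∧ z ≠ 0 := by
      rw [injective_iff_map_eq_zero] at hi
      push Not at hi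
      exact hi
    rw [hφ] at hxy
    have hy : y ≠ 0 := by
      rintro rfl
      rw [map_zero, LinearMap.zero_apply, add_zero] at hxy
      exact h0 (by rw [hinj x m hm hxy]; rfl)
    obtain ⟨y', hy'⟩ := (isUnit_of_nrd_ne_zero fun hn => hy (h₁ y hn)).exists_left_inv
    have hz : f₁ (-(y' * x)) m = U m := by
      have := congrArg (f₁ y') hxy
      rw [map_add, ← Module.End.mul_apply, ← Module.End.mul_apply, ← map_mul, ← map_mul, hy',
        map_one, Module.End.one_apply, map_zero] at this
      rw [map_neg, LinearMap.neg_apply]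
      exact (eq_neg_of_add_eq_zero_right this).symm
    obtain ⟨z, hz'⟩ : ∃ z, z = -(y' * x) := ⟨_, rfl⟩
    rw [← hz'] at hz
    have hzz : z * z = (1 : F) • z + algebraMap F _ a₂ := by
      rw [← sub_eq_zero]
      refine hinj _ m hm ?_
      have := hUU m
      rw [← hz, hU, ← hz] at this
      simp only [map_add, map_sub, map_mul, map_smul, Module.End.mul_apply, LinearMap.add_apply,
        LinearMap.sub_apply, LinearMap.smul_apply, AlgHom.commutes,
        Module.algebraMap_end_apply, this]
      module
    have hzim : z.im ≠ 0 := by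
      intro hzim
      obtain ⟨p, rfl⟩ : ∃ p, z = algebraMap F _ p := exists_eq_algebraMap_of_im_eq_zero hzim
      have e := congrArg re hzz
      simp [algebraMap_eq] at e
      exact sq_add_self_ne_of_division h₂ p (by linear_combination e + p * h2)
    obtain ⟨e1, e2⟩ := imI_and_nrd_of_mul_self_eq hzim hzz
    refine ⟨z, ⟨0, 1, 0, 0⟩, e1, ?_, hzim, fun h => by simpa using congrArg imI h⟩
    rw [e2]
    simp [nrd]
    linear_combination a₂ * h2

theorem exists_common_slot_of_commute_end [CharP F 2] {a₁ b₁ a₂ b₂ : F} (hb₁ : b₁ ≠ 0)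
    (hb₂ : b₂ ≠ 0) {V : Type*} [AddCommGroup V] [Module F V] (hV : Module.finrank F V = 8)
    (f₁ : ℍ[F,a₁,1,b₁] →ₐ[F] Module.End F V) (f₂ : ℍ[F,a₂,1,b₂] →ₐ[F] Module.End F V)
    (hf : ∀ x y, Commute (f₁ x) (f₂ y)) :
    ∃ a c₁ c₂ : F, c₁ ≠ 0 ∧ c₂ ≠ 0 ∧ Nonempty (ℍ[F,a,1,c₁] ≃ₐ[F] ℍ[F,a₁,1,b₁]) ∧
      Nonempty (ℍ[F,a,1,c₂] ≃ₐ[F] ℍ[F,a₂,1,b₂]) := by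
  by_cases h₁ : ∀ x : ℍ[F,a₁,1,b₁], nrd x = 0 → x = 0
  · by_cases h₂ : ∀ x : ℍ[F,a₂,1,b₂], nrd x = 0 → x = 0
    · obtain ⟨z, w, hI, hn, hz, hw⟩ := exists_nrd_eq_of_commute_end hb₁ h₁ h₂ hV f₁ f₂ hf
      exact exists_common_slot_of_nrd_eq hb₁ hb₂ h₁ hI hn hz hw
    · push Not at h₂
      obtain ⟨x, hn, hx⟩ := h₂
      obtain ⟨e⟩ := nonempty_algEquiv_matrix_of_nrd_eq_zero hb₂ hx hn
      obtain ⟨g⟩ := nonempty_algEquiv_matrix_one a₁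
      exact ⟨a₁, b₁, 1, hb₁, one_ne_zero, ⟨.refl⟩, ⟨g.trans e.symm⟩⟩
  · push Not at h₁
    obtain ⟨x, hn, hx⟩ := h₁
    obtain ⟨e⟩ := nonempty_algEquiv_matrix_of_nrd_eq_zero hb₁ hx hn
    obtain ⟨g⟩ := nonempty_algEquiv_matrix_one a₂
    exact ⟨a₂, 1, b₂, one_ne_zero, hb₂, ⟨g.trans e.symm⟩, ⟨.refl⟩⟩

theorem nonempty_algEquiv_of_commute_end_of_division [CharP F 2] {a₁ b₁ a₂ b₂ : F}
    (hb₂ : b₂ ≠ 0) (h₁ : ∀ x : ℍ[F,a₁,1,b₁], nrd x = 0 → x = 0)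
    {V : Type*} [AddCommGroup V] [Module F V] (hV : Module.finrank F V = 4)
    (f₁ : ℍ[F,a₁,1,b₁] →ₐ[F] Module.End F V) (f₂ : ℍ[F,a₂,1,b₂] →ₐ[F] Module.End F V)
    (hf : ∀ x y, Commute (f₁ x) (f₂ y)) :
    Nonempty (ℍ[F,a₂,1,b₂] ≃ₐ[F] ℍ[F,a₁,1,b₁]) := by
  have : Module.Finite F V := Module.finite_of_finrank_pos (by omega)
  have : Nontrivial V := Module.nontrivial_of_finrank_pos (R := F) (by omega)
  obtain ⟨m, hm⟩ := exists_ne (0 : V)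
  let φ : ℍ[F,a₁,1,b₁] →ₗ[F] V := LinearMap.applyₗ m ∘ₗ f₁.toLinearMap
  have hφ : ∀ x, φ x = f₁ x m := fun _ => rfl
  have hi : Function.Injective φ := by
    rw [injective_iff_map_eq_zero]
    intro x h
    by_contra hx
    obtain ⟨y, hy⟩ := (isUnit_of_nrd_ne_zero fun hn => hx (h₁ x hn)).exists_left_inv
    apply hm
    rw [← Module.End.one_apply (R := F) m, ← map_one f₁, ← hy, map_mul, Module.End.mul_apply,
      ← hφ, h, map_zero]
  have hs := (LinearMap.injective_iff_surjective_of_finrank_eq_finrank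
    (by rw [hV, finrank_eq_four])).1 hi
  choose ψ hψ using fun y => hs (f₂ y m)
  have hmul : ∀ y z, ψ (y * z) = ψ z * ψ y := by
    intro y z
    apply hi
    rw [hψ, map_mul, Module.End.mul_apply, ← hψ, hφ, hφ, map_mul, Module.End.mul_apply, ← hφ (ψ y),
      hψ]
    exact (LinearMap.congr_fun (hf (ψ z) y) m).symm
  have hadd : ∀ y z, ψ (y + z) = ψ y + ψ z := by
    intro y z
    apply hi
    rw [hψ, map_add, map_add, hψ, hψ, LinearMap.add_apply]
  have hsub : ∀ y z, ψ (y - z) = ψ y - ψ z := by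
    intro y z
    apply hi
    rw [hψ, map_sub, map_sub, hψ, hψ, LinearMap.sub_apply]
  have halg : ∀ r, ψ (algebraMap F _ r) = algebraMap F _ r := by
    intro r
    apply hi
    rw [hψ, hφ, AlgHom.commutes, AlgHom.commutes]
  have hst : ∀ r, star (algebraMap F ℍ[F,a₁,1,b₁] r) = algebraMap F _ r := by
    intro r
    rw [algebraMap_eq]
    ext <;> simp
  refine nonempty_algEquiv_of_hom hb₂
    (homOfRel (star (ψ ⟨0, 1, 0, 0⟩)) (star (ψ ⟨0, 0, 1, 0⟩)) ?_ ?_ ?_)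
  · rw [← star_mul, ← hmul, ← hst, ← halg, ← star_add, ← hadd]
    congr 2
    rw [algebraMap_eq]
    ext <;> simp
  · rw [← star_mul, ← hmul, ← hst, ← halg]
    congr 2
    rw [algebraMap_eq]
    ext <;> simp
  · rw [← star_mul, ← star_mul, ← hmul, ← hmul, ← star_sub, ← hsub]
    congr 2
    ext <;> simp

/-- Two quaternion algebras with commuting actions on a four-dimensional space are isomorphic. -/
theorem nonempty_algEquiv_of_commute_end [CharP F 2] {a₁ b₁ a₂ b₂ : F}
    (hb₁ : b₁ ≠ 0) (hb₂ : b₂ ≠ 0)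
    {V : Type*} [AddCommGroup V] [Module F V] (hV : Module.finrank F V = 4)
    (f₁ : ℍ[F,a₁,1,b₁] →ₐ[F] Module.End F V) (f₂ : ℍ[F,a₂,1,b₂] →ₐ[F] Module.End F V)
    (hf : ∀ x y, Commute (f₁ x) (f₂ y)) :
    Nonempty (ℍ[F,a₁,1,b₁] ≃ₐ[F] ℍ[F,a₂,1,b₂]) := by
  by_cases h₁ : ∀ x : ℍ[F,a₁,1,b₁], nrd x = 0 → x = 0
  · exact (nonempty_algEquiv_of_commute_end_of_division hb₂ h₁ hV f₁ f₂ hf).map .symm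
  by_cases h₂ : ∀ x : ℍ[F,a₂,1,b₂], nrd x = 0 → x = 0
  · exact nonempty_algEquiv_of_commute_end_of_division hb₁ h₂ hV f₂ f₁ fun x y => (hf y x).symm
  push Not at h₁ h₂
  obtain ⟨x, hnx, hx⟩ := h₁
  obtain ⟨y, hny, hy⟩ := h₂
  obtain ⟨e₁⟩ := nonempty_algEquiv_matrix_of_nrd_eq_zero hb₁ hx hnx
  obtain ⟨e₂⟩ := nonempty_algEquiv_matrix_of_nrd_eq_zero hb₂ hy hny
  exact ⟨e₁.trans e₂.symm⟩

/-- The restriction of an action to an invariant subspace. -/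
def restrictEnd {A V : Type*} [Ring A] [Algebra F A] [AddCommGroup V] [Module F V]
    (f : A →ₐ[F] Module.End F V) (K : Submodule F V) (hK : ∀ x, ∀ v ∈ K, f x v ∈ K) :
    A →ₐ[F] Module.End F K where
  toFun x := (f x).restrict (hK x)
  map_one' := by ext; simp
  map_mul' x y := by ext; simp
  map_zero' := by ext; simp
  map_add' x y := by ext; simp
  commutes' r := by ext; simp

/-- Three quaternion algebras with commuting actions on an eight-dimensional space, two of which
share a separable slot: the third has the product slot. -/
theorem nonempty_algEquiv_mul_of_commute_end [CharP F 2] {a c₁ c₂ a₃ b₃ : F}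
    (hc₁ : c₁ ≠ 0) (hc₂ : c₂ ≠ 0) (hb₃ : b₃ ≠ 0)
    {V : Type*} [AddCommGroup V] [Module F V] (hV : Module.finrank F V = 8)
    (f₁ : ℍ[F,a,1,c₁] →ₐ[F] Module.End F V) (f₂ : ℍ[F,a,1,c₂] →ₐ[F] Module.End F V)
    (f₃ : ℍ[F,a₃,1,b₃] →ₐ[F] Module.End F V) (h₁₂ : ∀ x y, Commute (f₁ x) (f₂ y))
    (h₁₃ : ∀ x y, Commute (f₁ x) (f₃ y)) (h₂₃ : ∀ x y, Commute (f₂ x) (f₃ y)) :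
    Nonempty (ℍ[F,a,1,c₁ * c₂] ≃ₐ[F] ℍ[F,a₃,1,b₃]) := by
  have : Module.Finite F V := Module.finite_of_finrank_pos (by omega)
  have hVV : ∀ x : V, x + x = 0 := fun x => by
    rw [← two_smul F, CharTwo.two_eq_zero, zero_smul]
  have hE : ∀ x : Module.End F V, x + x = 0 := add_self_eq_zero_of_charTwo F
  have hN : ∀ x : Module.End F V, -x = x := fun x => neg_eq_of_add_eq_zero_left (hE x)
  obtain ⟨p₁, q₁, r₁⟩ := map_generators_relations f₁
  obtain ⟨p₂, q₂, r₂⟩ := map_generators_relations f₂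
  have k₁ := h₁₂ ⟨0, 1, 0, 0⟩ ⟨0, 1, 0, 0⟩
  have k₂ := h₁₂ ⟨0, 1, 0, 0⟩ ⟨0, 0, 1, 0⟩
  have k₃ := h₁₂ ⟨0, 0, 1, 0⟩ ⟨0, 1, 0, 0⟩
  have k₄ := h₁₂ ⟨0, 0, 1, 0⟩ ⟨0, 0, 1, 0⟩
  have m₁ := h₁₃ ⟨0, 1, 0, 0⟩
  have m₂ := h₁₃ ⟨0, 0, 1, 0⟩
  have m₃ := h₂₃ ⟨0, 1, 0, 0⟩
  have m₄ := h₂₃ ⟨0, 0, 1, 0⟩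
  generalize f₁ ⟨0, 1, 0, 0⟩ = U₁ at *
  generalize f₁ ⟨0, 0, 1, 0⟩ = W₁ at *
  generalize f₂ ⟨0, 1, 0, 0⟩ = U₂ at *
  generalize f₂ ⟨0, 0, 1, 0⟩ = W₂ at *
  have s₁ : W₁ * U₁ = W₁ + U₁ * W₁ := by rw [r₁, sub_eq_add_neg, hN]
  have s₂ : W₂ * U₂ = W₂ + U₂ * W₂ := by rw [r₂, sub_eq_add_neg, hN]
  let f : ℍ[F,a,1,c₁ * c₂] →ₐ[F] Module.End F V := homOfRel U₁ (W₁ * W₂) p₁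
    (by rw [k₄.symm.mul_mul_mul_comm, q₁, q₂, map_mul])
    (by rw [mul_assoc, ← k₂.eq, ← mul_assoc, r₁, sub_mul, mul_assoc])
  let e := U₁ + U₂
  have he : e * e = e := by
    simp only [e, mul_add, add_mul, p₁, p₂, ← k₁.eq]
    calc _ = U₁ + U₂ + ((algebraMap F _ a + algebraMap F _ a) + (U₁ * U₂ + U₁ * U₂)) := by abel
      _ = U₁ + U₂ := by rw [hE, hE, add_zero, add_zero]
  have hW₂ : e * W₂ = W₂ + W₂ * e := by
    simp only [e, add_mul, mul_add, s₂, k₂.eq]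
    calc _ = (W₂ + W₂) + (W₂ * U₁ + U₂ * W₂) := by rw [hE, zero_add]
      _ = _ := by abel
  have hW₁ : e * W₁ = W₁ + W₁ * e := by
    simp only [e, add_mul, mul_add, s₁, k₃.eq]
    calc _ = (W₁ + W₁) + (U₁ * W₁ + U₂ * W₁) := by rw [hE, zero_add]
      _ = _ := by abel
  have hWW : Commute e (W₁ * W₂) := by
    change e * (W₁ * W₂) = W₁ * W₂ * e
    rw [← mul_assoc, hW₁, add_mul, mul_assoc, hW₂, mul_add, ← add_assoc, hE, zero_add, mul_assoc]
  have hU : Commute e U₁ := (Commute.refl U₁).add_left k₁.symm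
  have hf : ∀ x, Commute e (f x) := fun x => (commute_homOfRel _ _ _ hU.symm hWW.symm x).symm
  have hf₃ : ∀ x, Commute e (f₃ x) := fun x => (m₁ x).add_left (m₃ x)
  have hff₃ : ∀ x y, Commute (f x) (f₃ y) := fun x y =>
    commute_homOfRel _ _ _ (m₁ y) ((m₂ y).mul_left (m₄ y)) x
  let K := LinearMap.ker e
  have hKinv : ∀ g : Module.End F V, Commute e g → ∀ v ∈ K, g v ∈ K := by
    intro g hg v hv
    have := LinearMap.congr_fun hg v
    simp only [Module.End.mul_apply, LinearMap.mem_ker.1 hv, map_zero] at this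
    exact this
  have hrange : LinearMap.range e = K.map W₂ := by
    ext v
    constructor
    · rintro ⟨v, rfl⟩
      refine ⟨c₂⁻¹ • W₂ (e v), ?_, ?_⟩
      · have h1 := LinearMap.congr_fun hW₂ (e v)
        have h2 := LinearMap.congr_fun he v
        simp only [Module.End.mul_apply, LinearMap.add_apply] at h1 h2
        rw [h2, hVV] at h1
        change e _ = 0
        rw [map_smul, h1, smul_zero]
      · have h1 := LinearMap.congr_fun q₂ (e v)
        simp only [Module.End.mul_apply, Module.algebraMap_end_apply] at h1
        rw [map_smul, h1, smul_smul, inv_mul_cancel₀ hc₂, one_smul]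
    · rintro ⟨v, hv, rfl⟩
      refine ⟨W₂ v, ?_⟩
      have h1 := LinearMap.congr_fun hW₂ v
      simp only [Module.End.mul_apply, LinearMap.add_apply] at h1
      rw [h1, LinearMap.mem_ker.1 hv, map_zero, add_zero]
  have hinj : Function.Injective W₂ := by
    rw [injective_iff_map_eq_zero]
    intro v hv
    have h1 := LinearMap.congr_fun q₂ v
    rw [Module.End.mul_apply, hv, map_zero, Module.algebraMap_end_apply] at h1
    exact (smul_eq_zero.1 h1.symm).resolve_left hc₂
  have hK : Module.finrank F K = 4 := by
    have h1 := LinearMap.finrank_range_add_finrank_ker e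
    rw [hrange, ← (K.equivMapOfInjective W₂ hinj).finrank_eq, hV] at h1
    change _ + Module.finrank F K = _ at h1
    omega
  refine nonempty_algEquiv_of_commute_end (mul_ne_zero hc₁ hc₂) hb₃ hK
    (restrictEnd f K fun x => hKinv _ (hf x)) (restrictEnd f₃ K fun x => hKinv _ (hf₃ x))
    fun x y => ?_
  ext v
  exact LinearMap.congr_fun (hff₃ x y) v

theorem inv_smul_mul_inv_smul_of_mul_self_eq {A : Type*} [Ring A] [Algebra F A] {b c : F}
    (hc : c ≠ 0) {x : A} (hx : x * x = algebraMap F A (b * c * c)) :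
    (c⁻¹ • x) * (c⁻¹ • x) = algebraMap F A b := by
  rw [smul_mul_smul_comm, hx, Algebra.smul_def, ← map_mul]
  congr 1
  field_simp

theorem nonempty_tensor_hom [CharP F 2] {A : Type*} [Ring A] [Algebra F A] {a₁ b₁ a₂ b₂ : F}
    {i₁ j₁ i₂ j₂ : A}
    (hi₁ : i₁ * i₁ = algebraMap F A a₁ + i₁) (hj₁ : j₁ * j₁ = algebraMap F A b₁)
    (hji₁ : j₁ * i₁ = j₁ - i₁ * j₁)
    (hi₂ : i₂ * i₂ = algebraMap F A a₂ + i₂) (hj₂ : j₂ * j₂ = algebraMap F A b₂)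
    (hji₂ : j₂ * i₂ = j₂ - i₂ * j₂)
    (hii : Commute i₁ i₂) (hij : Commute i₁ j₂) (hji : Commute j₁ i₂) (hjj : Commute j₁ j₂) :
    ∃ f : ℍ[F,a₁,1,b₁] ⊗[F] ℍ[F,a₂,1,b₂] →ₐ[F] A,
      f (⟨0, 1, 0, 0⟩ ⊗ₜ 1) = i₁ ∧ f (⟨0, 0, 1, 0⟩ ⊗ₜ 1) = j₁ ∧
      f (1 ⊗ₜ ⟨0, 1, 0, 0⟩) = i₂ ∧ f (1 ⊗ₜ ⟨0, 0, 1, 0⟩) = j₂ := by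
  refine ⟨Algebra.TensorProduct.lift (homOfRel i₁ j₁ hi₁ hj₁ hji₁) (homOfRel i₂ j₂ hi₂ hj₂ hji₂)
    fun x y => commute_homOfRel _ _ _ (commute_homOfRel _ _ _ hii.symm hij.symm y).symm
      (commute_homOfRel _ _ _ hji.symm hjj.symm y).symm x, ?_, ?_, ?_, ?_⟩ <;>
    simp [homOfRel_apply]

theorem tensor_hom_ext {A : Type*} [Ring A] [Algebra F A] {a₁ b₁ a₂ b₂ : F}
    {f g : ℍ[F,a₁,1,b₁] ⊗[F] ℍ[F,a₂,1,b₂] →ₐ[F] A}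
    (h₁ : f (⟨0, 1, 0, 0⟩ ⊗ₜ 1) = g (⟨0, 1, 0, 0⟩ ⊗ₜ 1))
    (h₂ : f (⟨0, 0, 1, 0⟩ ⊗ₜ 1) = g (⟨0, 0, 1, 0⟩ ⊗ₜ 1))
    (h₃ : f (1 ⊗ₜ ⟨0, 1, 0, 0⟩) = g (1 ⊗ₜ ⟨0, 1, 0, 0⟩))
    (h₄ : f (1 ⊗ₜ ⟨0, 0, 1, 0⟩) = g (1 ⊗ₜ ⟨0, 0, 1, 0⟩)) : f = g :=
  Algebra.TensorProduct.ext (QuaternionAlgebra.hom_ext h₁ h₂) (QuaternionAlgebra.hom_ext h₃ h₄)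

theorem tensor_generators_relations (a₁ b₁ a₂ b₂ : F) :
    ∃ i₁ j₁ i₂ j₂ : ℍ[F,a₁,1,b₁] ⊗[F] ℍ[F,a₂,1,b₂],
      i₁ = ⟨0, 1, 0, 0⟩ ⊗ₜ 1 ∧ j₁ = ⟨0, 0, 1, 0⟩ ⊗ₜ 1 ∧
      i₂ = 1 ⊗ₜ ⟨0, 1, 0, 0⟩ ∧ j₂ = 1 ⊗ₜ ⟨0, 0, 1, 0⟩ ∧
      (i₁ * i₁ = algebraMap F _ a₁ + i₁ ∧ j₁ * j₁ = algebraMap F _ b₁ ∧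
        j₁ * i₁ = j₁ - i₁ * j₁) ∧
      (i₂ * i₂ = algebraMap F _ a₂ + i₂ ∧ j₂ * j₂ = algebraMap F _ b₂ ∧
        j₂ * i₂ = j₂ - i₂ * j₂) ∧
      Commute i₁ i₂ ∧ Commute i₁ j₂ ∧ Commute j₁ i₂ ∧ Commute j₁ j₂ :=
  ⟨_, _, _, _, rfl, rfl, rfl, rfl,
    map_generators_relations Algebra.TensorProduct.includeLeft,
    map_generators_relations
      (Algebra.TensorProduct.includeRight : _ →ₐ[F] ℍ[F,a₁,1,b₁] ⊗[F] ℍ[F,a₂,1,b₂]),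
    by simp [Commute, SemiconjBy], by simp [Commute, SemiconjBy], by simp [Commute, SemiconjBy],
    by simp [Commute, SemiconjBy]⟩

/-- The common slot relation `[a,c₁) ⊗ [a,c₂) ≃ [a,c₁c₂) ⊗ M₂`. -/
theorem nonempty_tensor_algEquiv [CharP F 2] {a c₁ c₂ : F} (hc₂ : c₂ ≠ 0) :
    Nonempty (ℍ[F,a,1,c₁] ⊗[F] ℍ[F,a,1,c₂] ≃ₐ[F]
      ℍ[F,a,1,c₁ * c₂] ⊗[F] Matrix (Fin 2) (Fin 2) F) := by
  obtain ⟨s⟩ := nonempty_algEquiv_matrix_of_eq_sq_add_self (a := 0) (r := 0) hc₂ (by simp)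
  have hE : ∀ x : ℍ[F,a,1,c₁] ⊗[F] ℍ[F,a,1,c₂], x + x = 0 := add_self_eq_zero_of_charTwo F
  have hN := fun x => neg_eq_of_add_eq_zero_left (hE x)
  have hE' : ∀ x : ℍ[F,a,1,c₁ * c₂] ⊗[F] ℍ[F,0,1,c₂], x + x = 0 :=
    add_self_eq_zero_of_charTwo F
  have hN' := fun x => neg_eq_of_add_eq_zero_left (hE' x)
  obtain ⟨U₁, W₁, U₂, W₂, hU₁, hW₁, hU₂, hW₂, ⟨p₁, q₁, r₁⟩, ⟨p₂, q₂, r₂⟩, k₁, k₂, k₃, k₄⟩ :=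
    tensor_generators_relations a c₁ a c₂
  obtain ⟨I, J, E, W, hI, hJ, hE₀, hW, ⟨x₁, y₁, z₁⟩, ⟨x₂, y₂, z₂⟩, l₁, l₂, l₃, l₄⟩ :=
    tensor_generators_relations a (c₁ * c₂) 0 c₂
  rw [map_zero, zero_add] at x₂
  rw [sub_eq_add_neg, hN] at r₁ r₂
  rw [sub_eq_add_neg, hN'] at z₁ z₂
  obtain ⟨f, f₁, f₂, f₃, f₄⟩ := nonempty_tensor_hom (F := F)
    (a₁ := a) (b₁ := c₁ * c₂) (a₂ := 0) (b₂ := c₂)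
    (i₁ := U₁) (j₁ := W₁ * W₂) (i₂ := U₁ + U₂) (j₂ := W₂) p₁
    (by rw [k₄.symm.mul_mul_mul_comm, q₁, q₂, map_mul])
    (by rw [sub_eq_add_neg, hN, mul_assoc, ← k₂.eq, ← mul_assoc, r₁, add_mul, mul_assoc])
    (by
      rw [map_zero, zero_add, mul_add, add_mul, add_mul, p₁, p₂, ← k₁.eq]
      calc _ = U₁ + U₂ + ((algebraMap F _ a + algebraMap F _ a) + (U₁ * U₂ + U₁ * U₂)) := by abel
        _ = U₁ + U₂ := by rw [hE, hE, add_zero, add_zero])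
    q₂
    (by rw [sub_eq_add_neg, hN, mul_add, add_mul, r₂, k₂.eq]; abel)
    ((Commute.refl _).add_right k₁) k₂
    (by
      change W₁ * W₂ * (U₁ + U₂) = (U₁ + U₂) * (W₁ * W₂)
      rw [mul_add, add_mul, mul_assoc, ← k₂.eq, ← mul_assoc, r₁, mul_assoc W₁, r₂, add_mul,
        mul_add, ← mul_assoc W₁ U₂, k₃.eq, mul_assoc, mul_assoc]
      calc _ = U₁ * (W₁ * W₂) + U₂ * (W₁ * W₂) + (W₁ * W₂ + W₁ * W₂) := by abel
        _ = _ := by rw [hE, add_zero])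
    (k₄.mul_left (Commute.refl _))
  obtain ⟨g, g₁, g₂, g₃, g₄⟩ := nonempty_tensor_hom (F := F)
    (a₁ := a) (b₁ := c₁) (a₂ := a) (b₂ := c₂)
    (i₁ := I) (j₁ := c₂⁻¹ • (J * W)) (i₂ := I + E) (j₂ := W) x₁
    (by
      refine inv_smul_mul_inv_smul_of_mul_self_eq hc₂ ?_
      rw [l₄.symm.mul_mul_mul_comm, y₁, y₂, ← map_mul])
    (by
      rw [sub_eq_add_neg, hN', smul_mul_assoc, mul_smul_comm, ← smul_add, mul_assoc, ← l₂.eq,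
        ← mul_assoc, z₁, add_mul, mul_assoc])
    (by
      rw [mul_add, add_mul, add_mul, x₁, x₂, ← l₁.eq]
      calc _ = algebraMap F _ a + (I + E) + (I * E + I * E) := by abel
        _ = _ := by rw [hE', add_zero])
    y₂
    (by rw [sub_eq_add_neg, hN', mul_add, add_mul, z₂, l₂.eq]; abel)
    ((Commute.refl _).add_right l₁) l₂
    (by
      refine Commute.smul_left ?_ _
      change J * W * (I + E) = (I + E) * (J * W)
      rw [mul_add, add_mul, mul_assoc, ← l₂.eq, ← mul_assoc, z₁, mul_assoc J, z₂, add_mul,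
        mul_add, ← mul_assoc J E, l₃.eq, mul_assoc, mul_assoc]
      calc _ = I * (J * W) + E * (J * W) + (J * W + J * W) := by abel
        _ = _ := by rw [hE', add_zero])
    ((l₄.mul_left (Commute.refl _)).smul_left _)
  rw [← hU₁] at g₁
  rw [← hW₁] at g₂
  rw [← hU₂] at g₃
  rw [← hW₂] at g₄
  rw [← hI] at f₁
  rw [← hJ] at f₂
  rw [← hE₀] at f₃
  rw [← hW] at f₄
  have hfg : f.comp g = AlgHom.id F _ := by
    apply tensor_hom_ext
    · rw [← hU₁, AlgHom.comp_apply, g₁, f₁, AlgHom.id_apply]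
    · rw [← hW₁, AlgHom.comp_apply, g₂, map_smul, map_mul, f₂, f₄, mul_assoc, q₂,
        ← Algebra.commutes, ← Algebra.smul_def, smul_smul, inv_mul_cancel₀ hc₂, one_smul,
        AlgHom.id_apply]
    · rw [← hU₂, AlgHom.comp_apply, g₃, map_add, f₁, f₃, ← add_assoc, hE, zero_add,
        AlgHom.id_apply]
    · rw [← hW₂, AlgHom.comp_apply, g₄, f₄, AlgHom.id_apply]
  have hgf : g.comp f = AlgHom.id F _ := by
    apply tensor_hom_ext
    · rw [← hI, AlgHom.comp_apply, f₁, g₁, AlgHom.id_apply]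
    · rw [← hJ, AlgHom.comp_apply, f₂, map_mul, g₂, g₄, smul_mul_assoc, mul_assoc, y₂,
        ← Algebra.commutes, ← Algebra.smul_def, smul_smul, inv_mul_cancel₀ hc₂, one_smul,
        AlgHom.id_apply]
    · rw [← hE₀, AlgHom.comp_apply, f₃, map_add, g₁, g₃, ← add_assoc, hE', zero_add,
        AlgHom.id_apply]
    · rw [← hW, AlgHom.comp_apply, f₄, g₄, AlgHom.id_apply]
  exact ⟨(AlgEquiv.ofAlgHom g f hgf hfg).trans (Algebra.TensorProduct.congr .refl s)⟩

/-- `[a,c₁) ⊗ [a,c₂) ⊗ [a,c₁c₂)` is split. -/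
theorem nonempty_tensor_algEquiv_matrix [CharP F 2] {a c₁ c₂ : F} (hc₁ : c₁ ≠ 0)
    (hc₂ : c₂ ≠ 0) :
    Nonempty ((ℍ[F,a,1,c₁] ⊗[F] ℍ[F,a,1,c₂]) ⊗[F] ℍ[F,a,1,c₁ * c₂] ≃ₐ[F]
      Matrix (Fin 8) (Fin 8) F) := by
  have hc : c₁ * c₂ ≠ 0 := mul_ne_zero hc₁ hc₂
  obtain ⟨e₁⟩ := nonempty_tensor_algEquiv (a := a) (c₁ := c₁) hc₂
  obtain ⟨e₂⟩ := nonempty_tensor_algEquiv (a := a) (c₁ := c₁ * c₂) hc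
  obtain ⟨e₃⟩ := nonempty_algEquiv_matrix_of_norm (a := a) (p := c₁ * c₂) (q := 0)
    (mul_ne_zero hc hc) (by ring)
  let r : (Fin 2 × Fin 2) × Fin 2 ≃ Fin 8 := Fintype.equivFinOfCardEq (by simp)
  exact ⟨(Algebra.TensorProduct.congr e₁ .refl).trans <|
    (Algebra.TensorProduct.comm F _ _).trans <|
    (Algebra.TensorProduct.leftComm F _ _ _).trans <|
    (Algebra.TensorProduct.assoc F F F _ _ _).symm.trans <|
    (Algebra.TensorProduct.congr (e₂.trans (Algebra.TensorProduct.congr e₃ .refl)) .refl).trans <|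
    (Algebra.TensorProduct.congr (Matrix.kroneckerAlgEquiv (Fin 2) (Fin 2) F) .refl).trans <|
    (Matrix.kroneckerAlgEquiv (Fin 2 × Fin 2) (Fin 2) F).trans (Matrix.reindexAlgEquiv F F r)⟩

end QuaternionAlgebra

/-- The presented algebra `QuatAlg F a b` is the quaternion algebra `ℍ[F,a,1,b]`. -/
theorem QuatAlg.nonempty_algEquiv (a b : F) : Nonempty (QuatAlg F a b ≃ₐ[F] ℍ[F,a,1,b]) := by
  let g : FreeAlgebra F (Fin 2) →ₐ[F] ℍ[F,a,1,b] :=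
    FreeAlgebra.lift F ![⟨0, 1, 0, 0⟩, ⟨0, 0, 1, 0⟩]
  have hg : ∀ ⦃x y⦄, QuatRel F a b x y → g x = g y := by
    rintro _ _ (_ | _ | _) <;> ext <;> simp [g]
  let f : QuatAlg F a b →ₐ[F] ℍ[F,a,1,b] := RingQuot.liftAlgHom F ⟨g, hg⟩
  let π : FreeAlgebra F (Fin 2) →ₐ[F] QuatAlg F a b := RingQuot.mkAlgHom F (QuatRel F a b)
  have hπ : ∀ ⦃x y⦄, QuatRel F a b x y → π x = π y := fun x y h => RingQuot.mkAlgHom_rel F h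
  have h1 := hπ QuatRel.u_sq
  have h2 := hπ QuatRel.v_sq
  have h3 := hπ QuatRel.vu
  simp only [map_mul, map_sub, map_one, AlgHom.commutes] at h1 h2 h3
  let h : ℍ[F,a,1,b] →ₐ[F] QuatAlg F a b :=
    QuaternionAlgebra.homOfRel (π (FreeAlgebra.ι F 0)) (π (FreeAlgebra.ι F 1))
      (sub_eq_iff_eq_add.1 h1) h2 (by rw [h3, sub_mul, one_mul])
  have hf : ∀ x, f (π x) = g x := fun x => RingQuot.liftAlgHom_mkAlgHom_apply F g hg x
  refine ⟨AlgEquiv.ofAlgHom f h ?_ ?_⟩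
  · ext <;> simp [h, QuaternionAlgebra.homOfRel_apply, hf, g]
  · refine RingQuot.ringQuot_ext' F _ _ (FreeAlgebra.hom_ext ?_)
    funext i
    change h (f (π _)) = π _
    rw [hf]
    fin_cases i <;> simp [h, g, QuaternionAlgebra.homOfRel_apply]

theorem trdeg_adjoin_triple_le {k F : Type*} [Field k] [Field F] [Algebra k F] (x y z : F) :
    trdeg k (IntermediateField.adjoin k ({x, y, z} : Set F)) ≤ 3 := by
  set L := IntermediateField.adjoin k ({x, y, z} : Set F)
  let S : Set L := (↑) ⁻¹' ({x, y, z} : Set F)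
  have hS : Cardinal.mk S ≤ 3 := by
    refine (Cardinal.mk_preimage_of_injective _ _ Subtype.val_injective).trans ?_
    refine (Cardinal.mk_insert_le).trans ?_
    refine (add_le_add_left (Cardinal.mk_insert_le) 1).trans ?_
    rw [Cardinal.mk_singleton]
    norm_num
  have himg : ((↑) : L → F) '' S = {x, y, z} := by
    refine Set.image_preimage_eq_of_subset fun w hw => ?_
    exact ⟨⟨w, IntermediateField.subset_adjoin k _ hw⟩, rfl⟩
  have hL : IntermediateField.adjoin k S = ⊤ := by
    apply IntermediateField.map_injective L.val
    rw [IntermediateField.adjoin_map]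
    change IntermediateField.adjoin k (((↑) : L → F) '' S) = _
    rw [himg, ← AlgHom.fieldRange_eq_map, IntermediateField.fieldRange_val]
  have : Algebra.IsAlgebraic (Algebra.adjoin k S) L := by
    rw [← IntermediateField.isAlgebraic_adjoin_iff_top, hL, Algebra.isAlgebraic_iff_isIntegral]
    exact Algebra.isIntegral_of_surjective fun w => ⟨⟨w, trivial⟩, rfl⟩
  refine ciSup_le' fun s => ?_
  exact (s.2.cardinalMk_le_trdeg).trans ((Algebra.IsAlgebraic.trdeg_le_cardinalMk k S).trans hS)

theorem exists_commute_end_of_tensor {F A B C : Type*} [Field F] [Ring A] [Ring B] [Ring C]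
    [Algebra F A] [Algebra F B] [Algebra F C] {n : ℕ}
    (e : (A ⊗[F] B) ⊗[F] C ≃ₐ[F] Matrix (Fin n) (Fin n) F) :
    ∃ (f : A →ₐ[F] Module.End F (Fin n → F)) (g : B →ₐ[F] Module.End F (Fin n → F))
      (h : C →ₐ[F] Module.End F (Fin n → F)), (∀ x y, Commute (f x) (g y)) ∧
      (∀ x y, Commute (f x) (h y)) ∧ ∀ x y, Commute (g x) (h y) := by
  let φ : (A ⊗[F] B) ⊗[F] C →ₐ[F] Module.End F (Fin n → F) :=
    (e.trans Matrix.toLinAlgEquiv').toAlgHom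
  let l : A ⊗[F] B →ₐ[F] (A ⊗[F] B) ⊗[F] C := Algebra.TensorProduct.includeLeft
  refine ⟨φ.comp (l.comp Algebra.TensorProduct.includeLeft),
    φ.comp (l.comp Algebra.TensorProduct.includeRight),
    φ.comp Algebra.TensorProduct.includeRight, fun x y => ?_, fun x y => ?_, fun x y => ?_⟩ <;>
  · refine Commute.map ?_ φ
    simp [Commute, SemiconjBy, l]

end QuaternionChar2

set_option maxSynthPendingDepth 3 in
set_option maxHeartbeats 1000000 in
set_option synthInstance.maxHeartbeats 1000000 in
theorem stmt9 (k F : Type*) [Field k] [Field F] [Algebra k F] [CharP k 2]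
    (a₁ a₂ a₃ b₁ b₂ b₃ : F) (hb₁ : b₁ ≠ 0) (hb₂ : b₂ ≠ 0) (hb₃ : b₃ ≠ 0)
    (hsplit : Nonempty
      (((QuatAlg F a₁ b₁ ⊗[F] QuatAlg F a₂ b₂) ⊗[F] QuatAlg F a₃ b₃) ≃ₐ[F]
        Matrix (Fin 8) (Fin 8) F)) :
    ∃ L : IntermediateField k F, trdeg k L ≤ 3 ∧
      ∃ a c₁ c₂ : L, c₁ ≠ 0 ∧ c₂ ≠ 0 ∧
        Nonempty (QuatAlg F (a : F) (c₁ : F) ≃ₐ[F] QuatAlg F a₁ b₁) ∧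
        Nonempty (QuatAlg F (a : F) (c₂ : F) ≃ₐ[F] QuatAlg F a₂ b₂) ∧
        Nonempty (QuatAlg F (a : F) ((c₁ : F) * (c₂ : F)) ≃ₐ[F] QuatAlg F a₃ b₃) ∧
        Nonempty
          (((QuatAlg L a c₁ ⊗[L] QuatAlg L a c₂) ⊗[L] QuatAlg L a (c₁ * c₂)) ≃ₐ[L]
            Matrix (Fin 8) (Fin 8) L) := by
  have : CharP F 2 := charP_of_injective_algebraMap (algebraMap k F).injective 2
  obtain ⟨e⟩ := hsplit
  obtain ⟨s₁⟩ := QuatAlg.nonempty_algEquiv a₁ b₁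
  obtain ⟨s₂⟩ := QuatAlg.nonempty_algEquiv a₂ b₂
  obtain ⟨s₃⟩ := QuatAlg.nonempty_algEquiv a₃ b₃
  obtain ⟨f₁, f₂, f₃, h₁₂, h₁₃, h₂₃⟩ := exists_commute_end_of_tensor
    ((Algebra.TensorProduct.congr (Algebra.TensorProduct.congr s₁.symm s₂.symm) s₃.symm).trans e)
  have hV : Module.finrank F (Fin 8 → F) = 8 := by simp
  obtain ⟨a, c₁, c₂, hc₁, hc₂, ⟨g₁⟩, ⟨g₂⟩⟩ :=
    QuaternionAlgebra.exists_common_slot_of_commute_end hb₁ hb₂ hV f₁ f₂ h₁₂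
  obtain ⟨g₃⟩ := QuaternionAlgebra.nonempty_algEquiv_mul_of_commute_end hc₁ hc₂ hb₃ hV
    (f₁.comp g₁.toAlgHom) (f₂.comp g₂.toAlgHom) f₃ (fun x y => h₁₂ _ _) (fun x y => h₁₃ _ _)
    (fun x y => h₂₃ _ _)
  obtain ⟨t₁⟩ := QuatAlg.nonempty_algEquiv a c₁
  obtain ⟨t₂⟩ := QuatAlg.nonempty_algEquiv a c₂
  obtain ⟨t₃⟩ := QuatAlg.nonempty_algEquiv a (c₁ * c₂)
  let L := IntermediateField.adjoin k ({a, c₁, c₂} : Set F)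
  have hL : ({a, c₁, c₂} : Set F) ⊆ L := IntermediateField.subset_adjoin k _
  have : CharP L 2 := charP_of_injective_algebraMap (algebraMap k L).injective 2
  let a' : L := ⟨a, hL (by simp)⟩
  let c₁' : L := ⟨c₁, hL (by simp)⟩
  let c₂' : L := ⟨c₂, hL (by simp)⟩
  have hc₁' : c₁' ≠ 0 := fun h => hc₁ (congrArg Subtype.val h)
  have hc₂' : c₂' ≠ 0 := fun h => hc₂ (congrArg Subtype.val h)
  obtain ⟨r₁⟩ := QuatAlg.nonempty_algEquiv a' c₁'
  obtain ⟨r₂⟩ := QuatAlg.nonempty_algEquiv a' c₂'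
  obtain ⟨r₃⟩ := QuatAlg.nonempty_algEquiv a' (c₁' * c₂')
  obtain ⟨r⟩ := QuaternionAlgebra.nonempty_tensor_algEquiv_matrix (a := a') hc₁' hc₂'
  exact ⟨L, trdeg_adjoin_triple_le a c₁ c₂, a', c₁', c₂', hc₁', hc₂',
    ⟨(t₁.trans g₁).trans s₁.symm⟩, ⟨(t₂.trans g₂).trans s₂.symm⟩,
    ⟨(t₃.trans g₃).trans s₃.symm⟩,
    ⟨(Algebra.TensorProduct.congr (Algebra.TensorProduct.congr r₁ r₂) r₃).trans r⟩⟩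
end

section
/- Let F be a field of characteristic ≠ 2, let n ≥ 2, and let a₁, …, a_{n−1}, b₁, b₂ ∈ Fˣ. Write τ = ⟨⟨a₁,…,a_{n−1}⟩⟩ for the (n−1)-fold Pfister form, and set φ₁ = ⟨⟨b₁,a₁,…,a_{n−1}⟩⟩, φ₂ = ⟨⟨b₂,a₁,…,a_{n−1}⟩⟩, φ₃ = ⟨⟨b₁b₂,a₁,…,a_{n−1}⟩⟩. Assume that φ₁ and φ₂ are anisotropic, that the quadratic form (−b₁)·τ ⊥ b₂·τ is anisotropic, and that the quadratic form φ₁ ⊥ (−φ₂) ⊥ φ₃ is hyperbolic. Then there exists b₁' ∈ Fˣ with b₁' − 1 ≠ 0 such that φ₁ is isometric to ⟨⟨b₁',a₁,…,a_{n−1}⟩⟩, φ₂ is isometric to ⟨⟨b₁'−1,a₁,…,a_{n−1}⟩⟩, and φ₃ is isometric to ⟨⟨b₁'(b₁'−1),a₁,…,a_{n−1}⟩⟩. -/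
/-- The `n`-fold Pfister form `⟨⟨a₁,…,aₙ⟩⟩`: the diagonal quadratic form indexed by
subsets `S ⊆ {1,…,n}`, with the coefficient of the variable indexed by `S` equal to
`∏_{i ∈ S} (-aᵢ)`. -/
noncomputable def pfister (F : Type*) [Field F] {n : ℕ} (a : Fin n → F) :
    QuadraticForm F (Finset (Fin n) → F) :=
  QuadraticMap.weightedSumSquares F fun S : Finset (Fin n) => ∏ i ∈ S, (-a i)

/-- A quadratic form is hyperbolic if it is equivalent (isometric) to an orthogonal sum
of copies of the hyperbolic plane `⟨1, -1⟩`. -/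
def IsHyperbolic {F M : Type*} [Field F] [AddCommGroup M] [Module F M]
    (q : QuadraticForm F M) : Prop :=
  ∃ m : ℕ, QuadraticMap.Equivalent q
    (QuadraticMap.weightedSumSquares F fun p : Fin m × Fin 2 => if p.2 = 0 then (1 : F) else -1)

theorem QuadraticMap.Equivalent.smul {F M N : Type*} [Field F] [AddCommGroup M] [Module F M]
    [AddCommGroup N] [Module F N] {q : QuadraticForm F M} {q' : QuadraticForm F N}
    (h : q.Equivalent q') (c : F) : (c • q).Equivalent (c • q') := by
  obtain ⟨e⟩ := h
  exact ⟨⟨e.toLinearEquiv, fun x => congrArg (c • ·) (e.map_app x)⟩⟩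

theorem QuadraticMap.Equivalent.neg {F M N : Type*} [Field F] [AddCommGroup M] [Module F M]
    [AddCommGroup N] [Module F N] {q : QuadraticForm F M} {q' : QuadraticForm F N}
    (h : q.Equivalent q') : (-q).Equivalent (-q') := by
  obtain ⟨e⟩ := h
  exact ⟨⟨e.toLinearEquiv, fun x => congrArg (- ·) (e.map_app x)⟩⟩

theorem equivalent_sq_smul {F M : Type*} [Field F] [AddCommGroup M] [Module F M]
    (q : QuadraticForm F M) {c : F} (hc : c ≠ 0) : ((c ^ 2) • q).Equivalent q :=
  ⟨⟨LinearEquiv.smulOfNeZero F M c hc, fun x => by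
    simp [QuadraticMap.map_smul, pow_two]⟩⟩

/-- A form is round when it is similar to itself with any nonzero value it takes as factor. -/
def IsRound {F M : Type*} [Field F] [AddCommGroup M] [Module F M] (q : QuadraticForm F M) : Prop :=
  ∀ x, q x ≠ 0 → (q x • q).Equivalent q

theorem IsRound.of_equivalent {F M N : Type*} [Field F] [AddCommGroup M] [Module F M]
    [AddCommGroup N] [Module F N] {q : QuadraticForm F M} {q' : QuadraticForm F N}
    (hq : IsRound q) (h : q'.Equivalent q) : IsRound q' := by
  intro x hx
  obtain ⟨e⟩ := id h
  have hx' : q (e x) = q' x := e.map_app x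
  rw [← hx'] at hx ⊢
  exact ((h.smul _).trans (hq _ hx)).trans h.symm

/-- The map `(x, y) ↦ (x - βy, x + y)` is a similarity of `q ⊥ βq` with factor `1 + β`. -/
theorem equivalent_one_add_smul_prod {F M : Type*} [Field F] [AddCommGroup M] [Module F M]
    (q : QuadraticForm F M) {β : F} (hβ : 1 + β ≠ 0) :
    ((1 + β) • QuadraticMap.prod q (β • q)).Equivalent (QuadraticMap.prod q (β • q)) := by
  refine ⟨⟨LinearEquiv.ofLinearMap
    ((LinearMap.fst F M M - β • LinearMap.snd F M M).prod
      (LinearMap.fst F M M + LinearMap.snd F M M))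
    ((1 + β)⁻¹ • ((LinearMap.fst F M M + β • LinearMap.snd F M M).prod
      (LinearMap.snd F M M - LinearMap.fst F M M))) ?_ ?_, ?_⟩⟩
  · ext x <;> simp <;> match_scalars <;> field_simp <;> ring
  · ext x <;> simp <;> match_scalars <;> field_simp
  · rintro ⟨x, y⟩
    have h1 : q (x + y) = q x + q y + QuadraticMap.polar q x y := QuadraticMap.map_add q x y
    have h2 : q (x - β • y) = q x + β ^ 2 * q y - β * QuadraticMap.polar q x y := by
      rw [sub_eq_add_neg, ← neg_smul, QuadraticMap.map_add q, QuadraticMap.map_smul,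
        QuadraticMap.polar_smul_right]
      simp only [smul_eq_mul]; ring
    simp [h1, h2]
    ring

theorem smul_prod_smul_self {F M : Type*} [Field F] [AddCommGroup M] [Module F M]
    (q : QuadraticForm F M) (c β : F) :
    c • QuadraticMap.prod q (β • q) = QuadraticMap.prod (c • q) (β • c • q) := by
  ext ⟨x, y⟩
  simp
  ring

theorem IsRound.prod_smul {F M : Type*} [Field F] [AddCommGroup M] [Module F M]
    {q : QuadraticForm F M} (hq : IsRound q) (β : F) : IsRound (QuadraticMap.prod q (β • q)) := by
  rintro ⟨u, v⟩ hx
  have hval : QuadraticMap.prod q (β • q) (u, v) = q u + β * q v := by simp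
  rw [hval] at hx ⊢
  by_cases hv : q v = 0
  · rw [hv, mul_zero, add_zero] at hx ⊢
    rw [smul_prod_smul_self]
    exact (hq u hx).prod ((hq u hx).smul β)
  by_cases hu : q u = 0
  · rw [hu, zero_add] at hx ⊢
    have hβ : β ≠ 0 := left_ne_zero_of_mul hx
    have h : (β • q v • q).Equivalent (β • q) := (hq v hv).smul β
    have h' : (β • β • q v • q).Equivalent q := by
      rw [smul_smul, ← pow_two]
      exact (equivalent_sq_smul _ hβ).trans (hq v hv)
    rw [smul_prod_smul_self, mul_smul]
    exact (h.prod h').trans ⟨QuadraticMap.IsometryEquiv.prodComm _ _⟩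
  · set s := q u
    set t := q v
    have hst : (t • s • q).Equivalent q := ((hq u hu).smul t).trans (hq v hv)
    have hts : ((t / s) • q).Equivalent q := by
      have h := (equivalent_sq_smul ((t / s) • q) hu).symm
      have he : s ^ 2 • (t / s) • q = t • s • q := by
        rw [smul_smul, smul_smul]
        congr 1
        field_simp
      rw [he] at h
      exact h.trans hst
    have hb : (QuadraticMap.prod q ((β * (t / s)) • q)).Equivalent
        (QuadraticMap.prod q (β • q)) := by
      rw [mul_smul]
      exact (QuadraticMap.Equivalent.refl q).prod (hts.smul β)
    have h1 : s + β * t = s * (1 + β * (t / s)) := by field_simp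
    rw [h1] at hx ⊢
    refine (hb.symm.smul _).trans (QuadraticMap.Equivalent.trans ?_ hb)
    rw [mul_smul]
    refine ((equivalent_one_add_smul_prod q (right_ne_zero_of_mul hx)).smul s).trans ?_
    rw [smul_prod_smul_self]
    exact (hq u hu).prod ((hq u hu).smul _)

theorem pfister_apply_single_empty {F : Type*} [Field F] {k : ℕ} (a : Fin k → F) :
    pfister F a (Pi.single ∅ 1) = 1 := by
  rw [pfister, QuadraticMap.weightedSumSquares_apply, Finset.sum_eq_single ∅]
  · simp
  · intro S _ hS
    simp [hS]
  · simp

theorem pfister_cons_equivalent {F : Type*} [Field F] {k : ℕ} (a : Fin k → F) (b : F) :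
    (pfister F (Fin.cons b a : Fin (k + 1) → F)).Equivalent
      (QuadraticMap.prod (pfister F a) ((-b) • pfister F a)) := by
  have hnot : ∀ S : Finset (Fin k), (0 : Fin (k + 1)) ∉ S.map (Fin.succEmb k) := by simp
  let g : Finset (Fin k) ⊕ Finset (Fin k) → Finset (Fin (k + 1)) :=
    Sum.elim (fun S => S.map (Fin.succEmb k))
      (fun S => Finset.cons 0 (S.map (Fin.succEmb k)) (hnot S))
  have hg : Function.Bijective g := by
    rw [Fintype.bijective_iff_injective_and_card]
    refine ⟨?_, by simp [pow_succ, mul_two]⟩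
    rintro (S | S) (T | T) h
    · simpa [g] using h
    · exact absurd (h.symm.subset (Finset.mem_cons_self (h := hnot T) ..)) (hnot S)
    · exact absurd (h.subset (Finset.mem_cons_self (h := hnot S) ..)) (hnot T)
    · have h' := congrArg (Finset.erase · 0) h
      simpa [g, Finset.erase_insert (hnot _)] using h'
  let G := Equiv.ofBijective g hg
  refine ⟨⟨(LinearEquiv.funCongrLeft F F G).trans
    (LinearEquiv.sumArrowLequivProdArrow _ _ F F), fun x => ?_⟩⟩
  simp only [pfister, QuadraticMap.prod_apply, smul_apply,
    QuadraticMap.weightedSumSquares_apply]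
  rw [← G.sum_comp, Fintype.sum_sum_type, Finset.smul_sum]
  congr 1
  · refine Finset.sum_congr rfl fun S _ => ?_
    simp [G, g, LinearMap.funLeft]
  · refine Finset.sum_congr rfl fun S _ => ?_
    simp [G, g, LinearMap.funLeft, mul_assoc]

theorem isRound_pfister {F : Type*} [Field F] {k : ℕ} (a : Fin k → F) :
    IsRound (pfister F a) := by
  induction k with
  | zero =>
    intro x hx
    have h : pfister F a x = x ∅ ^ 2 := by
      rw [pfister, QuadraticMap.weightedSumSquares_apply, Fintype.sum_eq_single ∅
        fun S hS => absurd (Subsingleton.elim S ∅) hS]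
      simp [pow_two]
    rw [h] at hx ⊢
    exact equivalent_sq_smul _ (by simpa using hx)
  | succ k ih =>
    have h := pfister_cons_equivalent (Fin.tail a) (a 0)
    rw [Fin.cons_self_tail] at h
    exact ((ih (Fin.tail a)).prod_smul _).of_equivalent h

theorem IsHyperbolic.of_equivalent {F M N : Type*} [Field F] [AddCommGroup M] [Module F M]
    [AddCommGroup N] [Module F N] {q : QuadraticForm F M} {q' : QuadraticForm F N}
    (hq : IsHyperbolic q) (h : q'.Equivalent q) : IsHyperbolic q' := by
  obtain ⟨m, hm⟩ := hq
  exact ⟨m, h.trans hm⟩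

/-- A hyperbolic space contains a totally isotropic subspace of half its dimension. -/
theorem IsHyperbolic.exists_isotropic {F M : Type*} [Field F] [AddCommGroup M] [Module F M]
    {q : QuadraticForm F M} (hq : IsHyperbolic q) :
    ∃ W : Submodule F M, 2 * Module.finrank F W = Module.finrank F M ∧ ∀ w ∈ W, q w = 0 := by
  obtain ⟨m, ⟨e⟩⟩ := hq
  let d : (Fin m → F) →ₗ[F] (Fin m × Fin 2 → F) := LinearMap.funLeft F F Prod.fst
  have hd : Function.Injective d :=
    LinearMap.funLeft_injective_of_surjective F F _ Prod.fst_surjective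
  refine ⟨LinearMap.range (e.symm.toLinearEquiv.toLinearMap ∘ₗ d), ?_, ?_⟩
  · rw [LinearMap.finrank_range_of_inj (f := e.symm.toLinearEquiv.toLinearMap ∘ₗ d)
      (e.symm.toLinearEquiv.injective.comp hd),
      e.toLinearEquiv.finrank_eq]
    simp [mul_comm]
  · rintro _ ⟨x, rfl⟩
    refine (e.symm.map_app (d x)).trans ?_
    simp [QuadraticMap.weightedSumSquares_apply, Fintype.sum_prod_type, d, LinearMap.funLeft]

/-- A totally isotropic subspace `W` can be moved, without loss of dimension, into the orthogonal
complement of a given totally isotropic subspace `L`: take `(W ∩ L⊥) + L`. -/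
theorem exists_isotropic_orthogonal {F V : Type*} [Field F] [AddCommGroup V] [Module F V]
    [FiniteDimensional F V] (Q : QuadraticForm F V) (W L : Submodule F V)
    (hW : ∀ w ∈ W, Q w = 0) (hL : ∀ l ∈ L, Q l = 0) :
    ∃ W' : Submodule F V, Module.finrank F W ≤ Module.finrank F W' ∧
      (∀ w ∈ W', Q w = 0) ∧ ∀ w ∈ W', ∀ l ∈ L, QuadraticMap.polar Q w l = 0 := by
  have hpol : ∀ U : Submodule F V, (∀ w ∈ U, Q w = 0) →
      ∀ x ∈ U, ∀ y ∈ U, QuadraticMap.polar Q x y = 0 := fun U hU x hx y hy => by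
    simp [QuadraticMap.polar, hU _ (U.add_mem hx hy), hU _ hx, hU _ hy]
  let φ : W →ₗ[F] Module.Dual F L :=
    (Module.Dual.transpose (R := F) L.subtype) ∘ₗ Q.polarBilin ∘ₗ W.subtype
  let K := (W ⊓ L).comap L.subtype
  have hφ : ∀ (w : W) (l : L), φ w l = QuadraticMap.polar Q w l := fun _ _ => rfl
  have hrange : LinearMap.range φ ≤ K.dualAnnihilator := by
    rintro _ ⟨w, rfl⟩
    rw [Submodule.mem_dualAnnihilator]
    intro l hl
    rw [hφ]
    exact hpol W hW _ w.2 _ hl.1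
  let A := (LinearMap.ker φ).map W.subtype
  have hA : ∀ w ∈ A, w ∈ W ∧ ∀ l ∈ L, QuadraticMap.polar Q w l = 0 := by
    rintro _ ⟨w, hw, rfl⟩
    refine ⟨w.2, fun l hl => ?_⟩
    exact LinearMap.congr_fun (LinearMap.mem_ker.1 hw) ⟨l, hl⟩
  have hAf : Module.finrank F A = Module.finrank F (LinearMap.ker φ) :=
    Submodule.finrank_map_subtype_eq _ _
  have hKf : Module.finrank F K = Module.finrank F (W ⊓ L : Submodule F V) :=
    (Submodule.comapSubtypeEquivOfLe inf_le_right).finrank_eq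
  have hle : Module.finrank F (A ⊓ L : Submodule F V) ≤
      Module.finrank F (W ⊓ L : Submodule F V) :=
    Submodule.finrank_mono (inf_le_inf_right _ fun w hw => (hA w hw).1)
  have h1 := Submodule.finrank_mono hrange
  have h2 := Subspace.finrank_add_finrank_dualAnnihilator_eq K
  have h3 := LinearMap.finrank_range_add_finrank_ker φ
  have h4 := Submodule.finrank_sup_add_finrank_inf_eq A L
  refine ⟨A ⊔ L, by omega, fun w hw => ?_, fun w hw l hl => ?_⟩
  · obtain ⟨x, hx, y, hy, rfl⟩ := Submodule.mem_sup.1 hw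
    rw [QuadraticMap.map_add Q, hW x (hA x hx).1, hL y hy, (hA x hx).2 y hy]
    simp
  · obtain ⟨x, hx, y, hy, rfl⟩ := Submodule.mem_sup.1 hw
    rw [QuadraticMap.polar_add_left, (hA x hx).2 l hl, hpol L hL y hy l hl, add_zero]

theorem exists_ne_zero_apply_mem {F V U : Type*} [Field F] [AddCommGroup V] [Module F V]
    [AddCommGroup U] [Module F U] [FiniteDimensional F V] [FiniteDimensional F U]
    (f : U →ₗ[F] V) (W : Submodule F V)
    (h : Module.finrank F V < Module.finrank F U + Module.finrank F W) :
    ∃ z, z ≠ 0 ∧ f z ∈ W := by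
  have h1 := LinearMap.finrank_range_add_finrank_ker (W.mkQ ∘ₗ f)
  have h2 := W.finrank_quotient_add_finrank
  have h3 := (LinearMap.range (W.mkQ ∘ₗ f)).finrank_le
  have h4 : LinearMap.ker (W.mkQ ∘ₗ f) ≠ ⊥ := by
    rw [← Submodule.one_le_finrank_iff]
    omega
  obtain ⟨z, hz, hz0⟩ := Submodule.exists_mem_ne_zero_of_ne_bot h4
  exact ⟨z, hz0, by simpa using hz⟩

/-- If `⟨1, -b₁, -1, b₂, 1, -b₁b₂⟩ ⊗ q` is hyperbolic, then `q ⊥ -b₁q ⊥ ⟨b₂ q(e)⟩` is isotropic: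
split off `q ⊥ -q` and compare dimensions with a maximal totally isotropic subspace. -/
theorem exists_isotropic_of_isHyperbolic {F M : Type*} [Field F] [AddCommGroup M] [Module F M]
    [FiniteDimensional F M] (h2 : (2 : F) ≠ 0) (q : QuadraticForm F M) (hq : q.Anisotropic)
    (b₁ b₂ : F) (e : M)
    (h : IsHyperbolic (QuadraticMap.prod
      (QuadraticMap.prod (QuadraticMap.prod q ((-b₁) • q)) (-(QuadraticMap.prod q ((-b₂) • q))))
      (QuadraticMap.prod q ((-(b₁ * b₂)) • q)))) :
    ∃ (u v : M) (c : F), (u, v, c) ≠ 0 ∧ q u - b₁ * q v + b₂ * (c ^ 2 * q e) = 0 := by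
  obtain ⟨W, hWf, hW⟩ := h.exists_isotropic
  set Q := QuadraticMap.prod
      (QuadraticMap.prod (QuadraticMap.prod q ((-b₁) • q)) (-(QuadraticMap.prod q ((-b₂) • q))))
      (QuadraticMap.prod q ((-(b₁ * b₂)) • q))
  have hQ : ∀ x₁ x₂ x₃ x₄ x₅ x₆ : M, Q (((x₁, x₂), (x₃, x₄)), (x₅, x₆)) =
      q x₁ - b₁ * q x₂ - q x₃ + b₂ * q x₄ + q x₅ - b₁ * b₂ * q x₆ := by
    intros
    simp [Q]
    ring
  let i : M →ₗ[F] M × M := LinearMap.inl F M M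
  let L : Submodule F (((M × M) × (M × M)) × (M × M)) :=
    LinearMap.range ((i.prod i).prod 0)
  have hL : ∀ l ∈ L, Q l = 0 := by
    rintro _ ⟨x, rfl⟩
    exact (hQ x 0 x 0 0 0).trans (by simp)
  obtain ⟨W', hW'f, hW', hWL⟩ := exists_isotropic_orthogonal Q W L hW hL
  let f : (M × M × M × F) →ₗ[F] (((M × M) × (M × M)) × (M × M)) :=
    { toFun := fun z => (((z.1, z.2.2.1), (0, z.2.2.2 • e)), (z.2.1, 0))
      map_add' := fun z w => by simp [add_smul]
      map_smul' := fun r z => by simp [mul_smul] }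
  obtain ⟨⟨x, u, v, c⟩, hz, hzW⟩ := exists_ne_zero_apply_mem f W' (by
    simp only [Module.finrank_prod, Module.finrank_self] at hWf ⊢
    omega)
  have hfz : f (x, u, v, c) = (((x, v), (0, c • e)), (u, 0)) := rfl
  rw [hfz] at hzW
  have hx : x = 0 := by
    have h0 := hWL _ hzW (((x, 0), (x, 0)), (0, 0)) ⟨x, rfl⟩
    simp only [QuadraticMap.polar, Prod.mk_add_mk, hQ] at h0
    have hxx : q (x + x) = 4 * q x := by
      rw [← two_smul F, QuadraticMap.map_smul, smul_eq_mul]; ring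
    simp only [hxx, add_zero, zero_add, map_zero] at h0
    refine hq x (mul_left_cancel₀ h2 ?_)
    linear_combination h0
  subst hx
  refine ⟨u, v, c, fun h0 => hz (by rw [h0]; rfl), ?_⟩
  have h0 := hW' _ hzW
  rw [hQ, QuadraticMap.map_smul, map_zero, smul_eq_mul] at h0
  linear_combination h0

/-- If `q u - b₁ q v = -b₂`, both terms may be chosen nonzero. -/
theorem exists_ne_zero_values {F M : Type*} [Field F] [AddCommGroup M] [Module F M]
    (h2 : (2 : F) ≠ 0) (q : QuadraticForm F M) {b₁ b₂ : F} (hb₂ : b₂ ≠ 0)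
    {e : M} (he : q e = 1)
    (hq₁ : (QuadraticMap.prod q ((-b₁) • q)).Anisotropic)
    (hτ : (QuadraticMap.prod ((-b₁) • q) (b₂ • q)).Anisotropic)
    {u v : M} (h : q u - b₁ * q v = -b₂) :
    ∃ x y, q x ≠ 0 ∧ q y ≠ 0 ∧ q x - b₁ * q y = -b₂ := by
  have he0 : e ≠ 0 := by
    rintro rfl
    simp at he
  have hu : q u ≠ 0 := fun hu => by
    refine he0 (Prod.ext_iff.1 (hτ (v, e) ?_)).2
    simp [he]
    linear_combination h - hu
  by_cases hv : q v = 0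
  swap
  · exact ⟨u, v, hu, hv, h⟩
  rw [hv, mul_zero, sub_zero] at h
  have hsub : -b₂ - b₁ ≠ 0 := fun h0 => by
    refine he0 (Prod.ext_iff.1 (hq₁ (u, e) ?_)).2
    simp [he, h]
    linear_combination h0
  have hadd : -b₂ + b₁ ≠ 0 := fun h0 => by
    refine he0 (Prod.ext_iff.1 (hτ (e, e) ?_)).2
    simp [he]
    linear_combination -h0
  refine ⟨((-b₂ + b₁) / (-b₂ - b₁)) • u, (2 * -b₂ / (-b₂ - b₁)) • e, ?_, ?_, ?_⟩
  · simp [QuadraticMap.map_smul, h, hadd, hsub, hb₂]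
  · simp [QuadraticMap.map_smul, he, h2, hsub, hb₂]
  · simp only [QuadraticMap.map_smul, he, h, smul_eq_mul]
    field_simp
    ring

theorem pfister_cons_equivalent_of_mul {F : Type*} [Field F] {k : ℕ} (a : Fin k → F) (b : F)
    {c : F} (hc : (c • pfister F a).Equivalent (pfister F a)) :
    (pfister F (Fin.cons b a : Fin (k + 1) → F)).Equivalent
      (pfister F (Fin.cons (b * c) a : Fin (k + 1) → F)) := by
  refine (pfister_cons_equivalent a b).trans
    (QuadraticMap.Equivalent.trans ?_ (pfister_cons_equivalent a (b * c)).symm)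
  rw [neg_mul_eq_neg_mul, mul_smul]
  exact (QuadraticMap.Equivalent.refl _).prod (hc.symm.smul _)

theorem QuadraticMap.Anisotropic.of_equivalent {F M N : Type*} [Field F] [AddCommGroup M]
    [Module F M] [AddCommGroup N] [Module F N] {q : QuadraticForm F M} {q' : QuadraticForm F N}
    (hq : q.Anisotropic) (h : q.Equivalent q') : q'.Anisotropic := by
  obtain ⟨e⟩ := h
  intro x hx
  have := hq (e.symm x) ((e.symm.map_app x).trans hx)
  simpa using this

theorem stmt10 (F : Type*) [Field F] (hchar : ringChar F ≠ 2)
    (n : ℕ) (hn : 2 ≤ n) (a : Fin (n - 1) → F) (ha : ∀ i, a i ≠ 0)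
    (b₁ b₂ : F) (hb₁ : b₁ ≠ 0) (hb₂ : b₂ ≠ 0)
    (hφ₁ : (pfister F (Fin.cons b₁ a)).Anisotropic)
    (hφ₂ : (pfister F (Fin.cons b₂ a)).Anisotropic)
    (hτ : (QuadraticMap.prod ((-b₁) • pfister F a) (b₂ • pfister F a)).Anisotropic)
    (hhyp : IsHyperbolic
      (QuadraticMap.prod
        (QuadraticMap.prod (pfister F (Fin.cons b₁ a)) (-(pfister F (Fin.cons b₂ a))))
        (pfister F (Fin.cons (b₁ * b₂) a)))) :
    ∃ b₁' : F, b₁' ≠ 0 ∧ b₁' - 1 ≠ 0 ∧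
      QuadraticMap.Equivalent (pfister F (Fin.cons b₁ a)) (pfister F (Fin.cons b₁' a)) ∧
      QuadraticMap.Equivalent (pfister F (Fin.cons b₂ a)) (pfister F (Fin.cons (b₁' - 1) a)) ∧
      QuadraticMap.Equivalent (pfister F (Fin.cons (b₁ * b₂) a))
        (pfister F (Fin.cons (b₁' * (b₁' - 1)) a)) := by
  have h2 : (2 : F) ≠ 0 := Ring.two_ne_zero hchar
  have he := pfister_apply_single_empty a
  have hround := isRound_pfister a
  have hq₁ := hφ₁.of_equivalent (pfister_cons_equivalent a b₁)
  have hQ := hhyp.of_equivalent ((((pfister_cons_equivalent a b₁).prod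
    (pfister_cons_equivalent a b₂).neg).prod (pfister_cons_equivalent a (b₁ * b₂))).symm)
  set τ := pfister F a
  set e : Finset (Fin (n - 1)) → F := Pi.single ∅ 1
  have hτa : τ.Anisotropic := fun x hx =>
    (Prod.ext_iff.1 (hq₁ (x, 0) (by simp [hx]))).1
  obtain ⟨u, v, c, hne, h0⟩ := exists_isotropic_of_isHyperbolic h2 τ hτa b₁ b₂ e hQ
  have hc : c ≠ 0 := by
    rintro rfl
    have := hq₁ (u, v) (by simp; linear_combination h0)
    obtain ⟨rfl, rfl⟩ := Prod.ext_iff.1 this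
    exact hne rfl
  obtain ⟨x, y, hx, hy, hxy⟩ := exists_ne_zero_values h2 τ hb₂ he hq₁ hτ
    (u := c⁻¹ • u) (v := c⁻¹ • v) (by
      simp only [QuadraticMap.map_smul, smul_eq_mul]
      rw [he] at h0
      field_simp
      linear_combination h0)
  have hinv : ((τ x)⁻¹ • τ).Equivalent τ := by
    have h := equivalent_sq_smul ((τ x)⁻¹ • τ) hx
    rw [smul_smul, pow_two, mul_assoc, mul_inv_cancel₀ hx, mul_one] at h
    exact h.symm.trans (hround x hx)
  have hdiv : ((τ y * (τ x)⁻¹) • τ).Equivalent τ := by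
    rw [mul_smul]
    exact (hinv.smul _).trans (hround y hy)
  have hdiv' : ((τ y * (τ x)⁻¹ * (τ x)⁻¹) • τ).Equivalent τ := by
    rw [mul_smul]
    exact (hinv.smul _).trans hdiv
  have hb : b₁ * (τ y * (τ x)⁻¹) - 1 = b₂ * (τ x)⁻¹ := by
    field_simp
    linear_combination -hxy
  refine ⟨b₁ * (τ y * (τ x)⁻¹), by simp [hb₁, hx, hy], by simp [hb, hb₂, hx],
    pfister_cons_equivalent_of_mul a b₁ hdiv, ?_, ?_⟩
  · rw [hb]
    exact pfister_cons_equivalent_of_mul a b₂ hinv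
  · have hm : b₁ * (τ y * (τ x)⁻¹) * (b₁ * (τ y * (τ x)⁻¹) - 1) =
        b₁ * b₂ * (τ y * (τ x)⁻¹ * (τ x)⁻¹) := by
      rw [hb]
      ring
    rw [hm]
    exact pfister_cons_equivalent_of_mul a (b₁ * b₂) hdiv'
end
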